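/- Let T be a smooth irreducible constructible subset of the complex affine Grassmannian GrAff_i^ℂ(ℂ^n). Then T is a connected real submanifold, and for every nonempty Euclidean-open subset U ⊆ T one has L(U) = L(T); that is, T is a neat family. -/

import Mathlib

/-!
The complex affine Grassmannian `GrAff_i^ℂ(ℂ^n)` of `i`-dimensional complex affine
flats of `ℂ^n`.  A flat is presented by a parameter `p = (M, b)` where `M` is a
`(n-i) × n` matrix of full rank `n-i` and `b ∈ ℂ^{n-i}`; the flat is the solution set
`{x : Mx = b}` and its direction is `L(A) = ker M`.  The parameter space is a Zariski
open subset of `ℂ^{(n-i)n + (n-i)}`, and the natural map onto `GrAff_i^ℂ(ℂ^n)` is a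
Zariski-locally trivial principal `GL_{n-i}(ℂ)`-bundle; accordingly, a subset `T` of
`GrAff_i^ℂ(ℂ^n)` is constructible / Zariski closed / open / connected / irreducible /
smooth / a real submanifold exactly when its (saturated) preimage `pre T` in the
parameter space is, which is how these notions are rendered below.
-/

/-- Index type for the parameter space `ℂ^{kn + k}` of `(n-i) × n` matrices together
with right-hand sides (`k = n - i`). -/
abbrev PIdx (n k : ℕ) := (Fin k × Fin n) ⊕ Fin k

/-- The matrix component of a parameter. -/
def matP {n k : ℕ} (p : PIdx n k → ℂ) : Matrix (Fin k) (Fin n) ℂ :=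
  Matrix.of fun r c => p (Sum.inl (r, c))

/-- The right-hand-side component of a parameter. -/
def vecP {n k : ℕ} (p : PIdx n k → ℂ) : Fin k → ℂ := fun r => p (Sum.inr r)

/-- The set of full-rank parameters. -/
def paramSet (n k : ℕ) : Set (PIdx n k → ℂ) :=
  {p | Module.finrank ℂ (LinearMap.range (matP p).mulVecLin) = k}

/-- The affine flat `{x : Mx = b} ⊆ ℂ^n` presented by a parameter. -/
def flatP {n k : ℕ} (p : PIdx n k → ℂ) : Set (Fin n → ℂ) :=
  {x | (matP p).mulVec x = vecP p}

/-- The direction `L(A) = ker M` of the flat presented by a parameter. -/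
noncomputable def dirP {n k : ℕ} (p : PIdx n k → ℂ) : Submodule ℂ (Fin n → ℂ) :=
  LinearMap.ker (matP p).mulVecLin

/-- The complex affine Grassmannian `GrAff_i^ℂ(ℂ^n)`: the set of `i`-dimensional
complex affine flats `A ⊆ ℂ^n`. -/
def grAffC (n i : ℕ) : Set (Set (Fin n → ℂ)) :=
  {A | ∃ p ∈ paramSet n (n - i), A = flatP p}

/-- The (saturated) preimage in the parameter space of a family `T ⊆ GrAff_i^ℂ(ℂ^n)`
of flats. -/
def pre (n i : ℕ) (T : Set (Set (Fin n → ℂ))) : Set (PIdx n (n - i) → ℂ) :=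
  {p | p ∈ paramSet n (n - i) ∧ flatP p ∈ T}

/-- `L(T)`: the `ℂ`-linear span of the directions of the members of a (parametrized)
family of flats. -/
noncomputable def dirSpanC {n k : ℕ} (S : Set (PIdx n k → ℂ)) : Submodule ℂ (Fin n → ℂ) :=
  ⨆ p ∈ S, dirP p

/-- A Zariski closed subset of `ℂ^ι`: the common zero locus of a set of
polynomials. -/
def IsZariskiClosed {ι : Type*} (S : Set (ι → ℂ)) : Prop :=
  ∃ P : Set (MvPolynomial ι ℂ), S = {x | ∀ q ∈ P, MvPolynomial.eval x q = 0}

/-- Constructible subsets of `ℂ^ι`: finite Boolean combinations of Zariski closed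
sets. -/
inductive IsConstructibleSet {ι : Type*} : Set (ι → ℂ) → Prop
  | of_closed (S : Set (ι → ℂ)) : IsZariskiClosed S → IsConstructibleSet S
  | compl (S : Set (ι → ℂ)) : IsConstructibleSet S → IsConstructibleSet Sᶜ
  | union (S S' : Set (ι → ℂ)) : IsConstructibleSet S → IsConstructibleSet S' →
      IsConstructibleSet (S ∪ S')

/-- `S` is a smooth (`C^∞`) embedded real submanifold of the real normed space `E`:
near each of its points it is the zero set of a smooth submersion. -/
def IsSmoothSubmanifold {E : Type*} [NormedAddCommGroup E] [NormedSpace ℝ E]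
    (S : Set E) : Prop :=
  ∀ x ∈ S, ∃ (d : ℕ) (U : Set E) (f : E → (Fin d → ℝ)), IsOpen U ∧ x ∈ U ∧
    ContDiffOn ℝ (⊤ : ℕ∞) f U ∧ (∀ y ∈ U, Function.Surjective (fderiv ℝ f y)) ∧
    S ∩ U = {y ∈ U | f y = 0}

/-- A neat family of `i`-dimensional complex flats: a constructible subset
`T ⊆ GrAff_i^ℂ(ℂ^n)` which is a connected real submanifold and satisfies
`L(U) = L(T)` for every nonempty (Euclidean) open subset `U ⊆ T`. -/
def IsNeatFamilyC (n i : ℕ) (T : Set (Set (Fin n → ℂ))) : Prop :=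
  T ⊆ grAffC n i ∧ IsConstructibleSet (pre n i T) ∧ IsConnected (pre n i T) ∧
  IsSmoothSubmanifold (pre n i T) ∧
  ∀ V : Set (PIdx n (n - i) → ℂ), IsOpen V → (pre n i T ∩ V).Nonempty →
    dirSpanC (pre n i T ∩ V) = dirSpanC (pre n i T)

/-- A Zariski locally closed subset of `ℂ^ι`: the difference of two Zariski closed
sets. -/
def IsZariskiLocallyClosed {ι : Type*} (S : Set (ι → ℂ)) : Prop :=
  ∃ C D : Set (ι → ℂ), IsZariskiClosed C ∧ IsZariskiClosed D ∧ S = C \ D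

/-- `S` is a complex submanifold of `ℂ^ι` (in the Euclidean topology): near each of its
points it is the zero set of a holomorphic submersion.  For a locally closed algebraic
set this is precisely smoothness in the sense of algebraic geometry. -/
def IsComplexSubmanifold {ι : Type*} [Fintype ι] (S : Set (ι → ℂ)) : Prop :=
  ∀ x ∈ S, ∃ (d : ℕ) (U : Set (ι → ℂ)) (f : (ι → ℂ) → (Fin d → ℂ)), IsOpen U ∧ x ∈ U ∧
    DifferentiableOn ℂ f U ∧ (∀ y ∈ U, Function.Surjective (fderiv ℂ f y)) ∧
    S ∩ U = {y ∈ U | f y = 0}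

/-- A relatively Zariski closed subset `Z` of `GrAff_i^ℂ(ℂ^n)`. -/
def IsRelZariskiClosedFam (n i : ℕ) (Z : Set (Set (Fin n → ℂ))) : Prop :=
  Z ⊆ grAffC n i ∧ ∃ C : Set (PIdx n (n - i) → ℂ), IsZariskiClosed C ∧
    pre n i Z = C ∩ paramSet n (n - i)

/-- `T ⊆ GrAff_i^ℂ(ℂ^n)` is irreducible in the Zariski topology. -/
def IsIrreducibleFam (n i : ℕ) (T : Set (Set (Fin n → ℂ))) : Prop :=
  T.Nonempty ∧ ∀ Z₁ Z₂ : Set (Set (Fin n → ℂ)), IsRelZariskiClosedFam n i Z₁ →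
    IsRelZariskiClosedFam n i Z₂ → T ⊆ Z₁ ∪ Z₂ → T ⊆ Z₁ ∨ T ⊆ Z₂

/-- `T ⊆ GrAff_i^ℂ(ℂ^n)` is smooth in the sense of algebraic geometry: it is a locally
closed subvariety all of whose points are smooth points, i.e. its (saturated) preimage
in the parameter space is Zariski locally closed and a complex submanifold. -/
def IsSmoothFam (n i : ℕ) (T : Set (Set (Fin n → ℂ))) : Prop :=
  IsZariskiLocallyClosed (pre n i T) ∧ IsComplexSubmanifold (pre n i T)


section Helpers

open Filter Topology

/-- Liouville: an entire function of polynomial growth is a polynomial. -/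
theorem entire_growth_poly (M : ℕ) : ∀ (g : ℂ → ℂ) (_ : Differentiable ℂ g) (K : ℝ)
    (_ : ∀ s, ‖g s‖ ≤ K * (1 + ‖s‖) ^ M),
    ∃ p : Polynomial ℂ, p.natDegree ≤ M ∧ ∀ s, g s = p.eval s := by
  induction M with
  | zero =>
    intro g hg K hK
    refine ⟨Polynomial.C (g 0), by simp, fun s => ?_⟩
    rw [Polynomial.eval_C]
    refine hg.apply_eq_apply_of_bounded ?_ s 0
    rw [isBounded_iff_forall_norm_le]
    exact ⟨K, by rintro _ ⟨s, rfl⟩; simpa using hK s⟩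
  | succ M ih =>
    intro g hg K hK
    have hd : Differentiable ℂ (dslope g 0) := by
      rw [← differentiableOn_univ]
      exact (Complex.differentiableOn_dslope (Filter.univ_mem)).2 hg.differentiableOn
    have hcont : Continuous (dslope g 0) := hd.continuous
    obtain ⟨B, hB⟩ := (isCompact_closedBall (0:ℂ) 1).exists_bound_of_continuousOn hcont.continuousOn
    have hK0 : 0 ≤ K := by
      have := (norm_nonneg _).trans (hK 0)
      simpa using this
    have hB0 : 0 ≤ B := (norm_nonneg _).trans (hB 0 (by simp))
    obtain ⟨p, hp, hpe⟩ := ih (dslope g 0) hd (B + 4 * K) (by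
      intro s
      by_cases hs : ‖s‖ ≤ 1
      · have h1 := hB s (by simpa using hs)
        have h2 : (1:ℝ) ≤ (1 + ‖s‖) ^ M := one_le_pow₀ (by linarith [norm_nonneg s])
        nlinarith
      · push Not at hs
        have hs0 : s ≠ 0 := by rintro rfl; simp at hs; linarith
        rw [dslope_of_ne _ hs0, slope_def_field, sub_zero, norm_div, div_le_iff₀ (by linarith)]
        have h1 : ‖g s - g 0‖ ≤ K * (1 + ‖s‖) ^ (M+1) + K := by
          have := hK 0
          simp at this
          exact (norm_sub_le _ _).trans (add_le_add (hK s) this)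
        have h2 : (1:ℝ) ≤ (1 + ‖s‖) ^ M := one_le_pow₀ (by linarith [norm_nonneg s])
        rw [pow_succ] at h1
        set q := (1 + ‖s‖) ^ M
        have h3 : K * (q * (1 + ‖s‖)) ≤ K * (q * (2 * ‖s‖)) := by gcongr; linarith
        have h4 : K ≤ K * (q * ‖s‖) := by
          have : 1 ≤ q * ‖s‖ := by nlinarith
          nlinarith
        have h5 : 0 ≤ B * q * ‖s‖ := by positivity
        have h6 : 0 ≤ K * (q * ‖s‖) := by positivity
        nlinarith)
    refine ⟨Polynomial.C (g 0) + Polynomial.X * p, ?_, fun s => ?_⟩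
    · refine (Polynomial.natDegree_add_le _ _).trans ?_
      simp only [Polynomial.natDegree_C, zero_le, sup_of_le_right]
      refine Polynomial.natDegree_mul_le.trans ?_
      simp; omega
    · have := sub_smul_dslope g 0 s
      simp only [Polynomial.eval_add, Polynomial.eval_C, Polynomial.eval_mul, Polynomial.eval_X,
        ← hpe]
      simp at this
      rw [this]; ring

theorem lagrange_nodes (M : ℕ) (p : Polynomial ℂ) (hp : p.natDegree ≤ M) (s : ℂ) :
    p.eval s = ∑ k ∈ Finset.range (M+1), p.eval (k:ℂ) *
      (Lagrange.basis (Finset.range (M+1)) (fun k : ℕ => (k:ℂ)) k).eval s := by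
  have h := Lagrange.eq_interpolate (s := Finset.range (M+1)) (v := fun k : ℕ => (k:ℂ)) (f := p)
    (fun a _ b _ h => by simpa using h)
    (by
      rw [Finset.card_range]
      exact lt_of_le_of_lt Polynomial.degree_le_natDegree (by exact_mod_cast Nat.lt_succ_of_le hp))
  conv_lhs => rw [h]
  simp [Lagrange.interpolate_apply, Polynomial.eval_finset_sum]

/-- A separately entire function of polynomial growth is a polynomial. -/
theorem sep_entire_growth_poly (M : ℕ) (n : ℕ) : ∀ (H : (Fin n → ℂ) → ℂ)
    (_ : ∀ z i, Differentiable ℂ (fun s => H (Function.update z i s))) (K : ℝ)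
    (_ : ∀ z, ‖H z‖ ≤ K * (1 + ‖z‖) ^ M),
    ∃ p : MvPolynomial (Fin n) ℂ, ∀ z, H z = MvPolynomial.eval z p := by
  induction n with
  | zero =>
    intro H _ K _
    refine ⟨MvPolynomial.C (H 0), fun z => ?_⟩
    rw [MvPolynomial.eval_C, Subsingleton.elim z 0]
  | succ n ih =>
    intro H hH K hK
    have hK0 : 0 ≤ K := by
      have := (norm_nonneg _).trans (hK 0)
      simpa using this
    have hcons : ∀ (s : ℂ) (z : Fin n → ℂ),
        1 + ‖(Fin.cons s z : Fin (n+1) → ℂ)‖ ≤ (1 + ‖s‖) * (1 + ‖z‖) := by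
      intro s z
      have : ‖(Fin.cons s z : Fin (n+1) → ℂ)‖ ≤ ‖s‖ + ‖z‖ := by
        rw [pi_norm_le_iff_of_nonneg (by positivity)]
        intro i
        refine Fin.cases ?_ (fun j => ?_) i
        · simp
        · simp only [Fin.cons_succ]
          linarith [norm_le_pi_norm z j, norm_nonneg s]
      nlinarith [norm_nonneg s, norm_nonneg z]
    have hgr : ∀ (s : ℂ) (z : Fin n → ℂ),
        ‖H (Fin.cons s z)‖ ≤ K * (1 + ‖s‖) ^ M * (1 + ‖z‖) ^ M := by
      intro s z
      refine (hK _).trans ?_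
      rw [mul_assoc, ← mul_pow]
      gcongr
      exact hcons s z
    have hpoly : ∀ k : ℕ, ∃ p : MvPolynomial (Fin n) ℂ, ∀ z,
        H (Fin.cons (k:ℂ) z) = MvPolynomial.eval z p := by
      intro k
      refine ih (fun z => H (Fin.cons (k:ℂ) z)) ?_ (K * (1 + ‖(k:ℂ)‖) ^ M) (hgr k)
      intro z i
      simpa only [Fin.cons_update] using hH (Fin.cons (k:ℂ) z) i.succ
    choose P hP using hpoly
    refine ⟨∑ k ∈ Finset.range (M+1), MvPolynomial.rename Fin.succ (P k) *
      Polynomial.aeval (MvPolynomial.X 0)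
        (Lagrange.basis (Finset.range (M+1)) (fun k : ℕ => (k:ℂ)) k), fun z => ?_⟩
    obtain ⟨p, hp, hpe⟩ := entire_growth_poly M (fun s => H (Fin.cons s (Fin.tail z)))
      (by
        have := hH z 0
        have h2 : ∀ s, (Fin.cons s (Fin.tail z) : Fin (n+1) → ℂ) = Function.update z 0 s := by
          intro s
          conv_rhs => rw [← Fin.cons_self_tail z, Fin.update_cons_zero]
        simpa only [h2] using this) (K * (1 + ‖Fin.tail z‖) ^ M)
      (by intro s; refine (hgr s _).trans (le_of_eq (by ring)))
    have h1 : H z = p.eval (z 0) := by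
      have := hpe (z 0)
      simpa using this
    rw [h1, lagrange_nodes M p hp]
    simp only [map_sum, map_mul]
    refine Finset.sum_congr rfl fun k _ => ?_
    rw [← hpe, hP, MvPolynomial.eval_rename]
    congr 1
    rw [← MvPolynomial.coe_aeval_eq_eval, RingHom.coe_coe, ← Polynomial.aeval_algHom_apply]
    simp

/-- The specialization of a polynomial with polynomial coefficients. -/
noncomputable abbrev fib {d : ℕ} (F : Polynomial (MvPolynomial (Fin d) ℂ)) (y : Fin d → ℂ) :
    Polynomial ℂ := F.map (MvPolynomial.eval y)

/-- An explicit bound for the roots of a monic polynomial. -/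
noncomputable def rootBd {d : ℕ} (F : Polynomial (MvPolynomial (Fin d) ℂ)) (y : Fin d → ℂ) : ℝ :=
  1 + ∑ j ∈ Finset.range F.natDegree, ‖MvPolynomial.eval y (F.coeff j)‖

theorem rootBd_nonneg {d : ℕ} (F : Polynomial (MvPolynomial (Fin d) ℂ)) (y : Fin d → ℂ) :
    0 ≤ rootBd F y := by
  unfold rootBd; positivity

theorem rootBd_cont {d : ℕ} (F : Polynomial (MvPolynomial (Fin d) ℂ)) :
    Continuous (rootBd F) := by
  unfold rootBd
  refine continuous_const.add (continuous_finsetSum _ fun j _ => ?_)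
  exact (MvPolynomial.continuous_eval _).norm

theorem monic_root_bound (p : Polynomial ℂ) (hp : p.Monic) (t : ℂ) (ht : p.eval t = 0) :
    ‖t‖ ≤ 1 + ∑ j ∈ Finset.range p.natDegree, ‖p.coeff j‖ := by
  have hs : 0 ≤ ∑ j ∈ Finset.range p.natDegree, ‖p.coeff j‖ := by positivity
  by_cases h1 : ‖t‖ ≤ 1
  · linarith
  push Not at h1
  obtain ⟨m, hm⟩ : ∃ m, p.natDegree = m + 1 := by
    refine Nat.exists_eq_succ_of_ne_zero fun h => ?_
    rw [hp.natDegree_eq_zero] at h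
    simp [h] at ht
  rw [Polynomial.eval_eq_sum_range, Finset.sum_range_succ, hp.coeff_natDegree, one_mul] at ht
  have h2 : t ^ p.natDegree = - ∑ j ∈ Finset.range p.natDegree, p.coeff j * t ^ j :=
    eq_neg_of_add_eq_zero_right ht
  have h3 : ‖t‖ ^ p.natDegree ≤ (∑ j ∈ Finset.range p.natDegree, ‖p.coeff j‖) * ‖t‖ ^ m := by
    rw [← norm_pow, h2, norm_neg, Finset.sum_mul]
    refine (norm_sum_le _ _).trans (Finset.sum_le_sum fun j hj => ?_)
    rw [norm_mul, norm_pow]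
    gcongr
    · exact h1.le
    · rw [Finset.mem_range] at hj; omega
  rw [hm, pow_succ'] at h3
  rw [hm]
  have h4 : 0 < ‖t‖ ^ m := by positivity
  have := le_of_mul_le_mul_right h3 h4
  linarith

theorem fib_monic {d : ℕ} {F : Polynomial (MvPolynomial (Fin d) ℂ)} (hF : F.Monic)
    (y : Fin d → ℂ) : (fib F y).Monic := hF.map _

theorem fib_root_bound {d : ℕ} {F : Polynomial (MvPolynomial (Fin d) ℂ)} (hF : F.Monic)
    (y : Fin d → ℂ) (t : ℂ) (ht : (fib F y).eval t = 0) : ‖t‖ ≤ rootBd F y := by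
  have := monic_root_bound _ (fib_monic hF y) t ht
  rw [hF.natDegree_map] at this
  simpa [rootBd] using this

/-- Polynomial growth of a real valued function. -/
def PolyGrowth {E : Type*} [Norm E] (f : E → ℝ) : Prop :=
  ∃ (K : ℝ) (M : ℕ), 0 ≤ K ∧ ∀ y, f y ≤ K * (1 + ‖y‖) ^ M

section
variable {E : Type*} [SeminormedAddGroup E]

theorem PolyGrowth.const (c : ℝ) : PolyGrowth (fun _ : E => c) :=
  ⟨|c|, 0, abs_nonneg _, fun y => by simpa using le_abs_self c⟩

theorem PolyGrowth.mono {f g : E → ℝ} (hg : PolyGrowth g) (h : ∀ y, f y ≤ g y) :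
    PolyGrowth f := by
  obtain ⟨K, M, hK, hM⟩ := hg
  exact ⟨K, M, hK, fun y => (h y).trans (hM y)⟩

theorem PolyGrowth.add {f g : E → ℝ} (hf : PolyGrowth f) (hg : PolyGrowth g) :
    PolyGrowth (fun y => f y + g y) := by
  obtain ⟨K, M, hK, hM⟩ := hf
  obtain ⟨K', M', hK', hM'⟩ := hg
  refine ⟨K + K', max M M', by positivity, fun y => ?_⟩
  have h1 : 1 ≤ 1 + ‖y‖ := by linarith [norm_nonneg y]
  have h2 : K * (1 + ‖y‖) ^ M ≤ K * (1 + ‖y‖) ^ (max M M') := by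
    gcongr
    exact le_max_left _ _
  have h3 : K' * (1 + ‖y‖) ^ M' ≤ K' * (1 + ‖y‖) ^ (max M M') := by
    gcongr
    exact le_max_right _ _
  linarith [hM y, hM' y]

theorem PolyGrowth.mul {f g : E → ℝ} (hf : PolyGrowth f) (hg : PolyGrowth g)
    (h0 : ∀ y, 0 ≤ g y) : PolyGrowth (fun y => f y * g y) := by
  obtain ⟨K, M, hK, hM⟩ := hf
  obtain ⟨K', M', hK', hM'⟩ := hg
  refine ⟨K * K', M + M', by positivity, fun y => ?_⟩
  calc f y * g y ≤ (K * (1 + ‖y‖) ^ M) * (K' * (1 + ‖y‖) ^ M') := by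
        gcongr
        · exact h0 y
        · exact hM y
        · exact hM' y
    _ = _ := by rw [pow_add]; ring

theorem PolyGrowth.pow {f : E → ℝ} (hf : PolyGrowth f) (h0 : ∀ y, 0 ≤ f y) (n : ℕ) :
    PolyGrowth (fun y => f y ^ n) := by
  induction n with
  | zero => simpa using PolyGrowth.const (E := E) 1
  | succ n ih => simpa only [pow_succ] using ih.mul hf h0

theorem PolyGrowth.sum {ι : Type*} (s : Finset ι) (f : ι → E → ℝ)
    (hf : ∀ i ∈ s, PolyGrowth (f i)) : PolyGrowth (fun y => ∑ i ∈ s, f i y) := by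
  classical
  induction s using Finset.induction_on with
  | empty => simpa using PolyGrowth.const (E := E) 0
  | insert a s ha ih =>
    simp only [Finset.sum_insert ha]
    exact (hf a (by simp)).add (ih fun i hi => hf i (by simp [hi]))
end

theorem PolyGrowth.comp_tail {d : ℕ} {f : (Fin d → ℂ) → ℝ} (hf : PolyGrowth f) :
    PolyGrowth (fun z : Fin (d+1) → ℂ => f (Fin.tail z)) := by
  obtain ⟨K, M, hK, hM⟩ := hf
  refine ⟨K, M, hK, fun y => (hM _).trans ?_⟩
  gcongr
  rw [pi_norm_le_iff_of_nonneg (norm_nonneg _)]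
  intro i
  exact norm_le_pi_norm y i.succ

theorem PolyGrowth.eval {d : ℕ} (q : MvPolynomial (Fin d) ℂ) :
    PolyGrowth (fun y => ‖MvPolynomial.eval y q‖) := by
  induction q using MvPolynomial.induction_on with
  | C a => simpa using PolyGrowth.const (E := Fin d → ℂ) ‖a‖
  | add p q hp hq =>
    refine (hp.add hq).mono fun y => ?_
    rw [map_add]; exact norm_add_le _ _
  | mul_X p i hp =>
    have : PolyGrowth (fun y : Fin d → ℂ => ‖y i‖) :=
      ⟨1, 1, zero_le_one, fun y => by
        have := norm_le_pi_norm y i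
        simp only [pow_one, one_mul]; linarith⟩
    refine (hp.mul this fun y => norm_nonneg _).mono fun y => ?_
    simp

theorem PolyGrowth.rootBd {d : ℕ} (F : Polynomial (MvPolynomial (Fin d) ℂ)) :
    PolyGrowth (rootBd F) :=
  (PolyGrowth.const 1).add (PolyGrowth.sum _ _ fun _ _ => PolyGrowth.eval _)

theorem fib_eval_eq {d : ℕ} (F : Polynomial (MvPolynomial (Fin d) ℂ)) (y : Fin d → ℂ) (t : ℂ) :
    (fib F y).eval t =
      ∑ j ∈ Finset.range (F.natDegree + 1), MvPolynomial.eval y (F.coeff j) * t ^ j := by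
  rw [fib, Polynomial.eval_map, Polynomial.eval₂_eq_sum_range]

theorem eval_contDiff {d : ℕ} (q : MvPolynomial (Fin d) ℂ) :
    ContDiff ℂ 1 (fun y : Fin d → ℂ => MvPolynomial.eval y q) := by
  rw [← contDiffOn_univ]
  exact (AnalyticOnNhd.eval_mvPolynomial q).contDiffOn uniqueDiffOn_univ

theorem fib_contDiff {d : ℕ} (F : Polynomial (MvPolynomial (Fin d) ℂ)) :
    ContDiff ℂ 1 (fun z : (Fin d → ℂ) × ℂ => (fib F z.1).eval z.2) := by
  simp only [fib_eval_eq]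
  refine ContDiff.sum fun j _ => ?_
  exact ((eval_contDiff _).comp contDiff_fst).mul (contDiff_snd.pow _)

/-- Local holomorphic root functions at simple roots. -/
theorem fib_implicit {d : ℕ} (F : Polynomial (MvPolynomial (Fin d) ℂ)) (y₀ : Fin d → ℂ) (t₀ : ℂ)
    (h0 : (fib F y₀).eval t₀ = 0) (h1 : (fib F y₀).derivative.eval t₀ ≠ 0) :
    ∃ r : (Fin d → ℂ) → ℂ, DifferentiableAt ℂ r y₀ ∧ r y₀ = t₀ ∧
      ∀ᶠ y in 𝓝 y₀, (fib F y).eval (r y) = 0 := by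
  set f := fun z : (Fin d → ℂ) × ℂ => (fib F z.1).eval z.2 with hf
  have cdf : ContDiffAt ℂ 1 f (y₀, t₀) := (fib_contDiff F).contDiffAt
  have hder : HasDerivAt (fun t => f (y₀, t)) ((fib F y₀).derivative.eval t₀) t₀ :=
    (fib F y₀).hasDerivAt t₀
  have hder2 : HasFDerivAt (fun t => f (y₀, t))
      ((fderiv ℂ f (y₀, t₀)) ∘L .inr ℂ (Fin d → ℂ) ℂ) t₀ := by
    have := (cdf.differentiableAt one_ne_zero).hasFDerivAt
    exact HasFDerivAt.comp t₀ (f := fun t => (y₀, t)) this (hasFDerivAt_prodMk_right y₀ t₀)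
  have heq := hder2.unique hder.hasFDerivAt
  have inv : ((fderiv ℂ f (y₀, t₀)) ∘L .inr ℂ (Fin d → ℂ) ℂ).IsInvertible := by
    rw [heq]
    refine ⟨ContinuousLinearEquiv.unitsEquivAut ℂ (Units.mk0 _ h1), ?_⟩
    ext
    simp
  refine ⟨cdf.implicitFunction one_ne_zero inv,
    (cdf.hasStrictFDerivAt_implicitFunction one_ne_zero inv).hasFDerivAt.differentiableAt,
    cdf.implicitFunction_apply_self one_ne_zero inv, ?_⟩
  have := cdf.eventually_apply_implicitFunction one_ne_zero inv
  simpa [hf, h0] using this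

open Classical in
/-- The roots lying in a given set. -/
noncomputable def sel {d : ℕ} (F : Polynomial (MvPolynomial (Fin d) ℂ))
    (U : Set ((Fin d → ℂ) × ℂ)) (y : Fin d → ℂ) : Finset ℂ :=
  (fib F y).roots.toFinset.filter fun t => (y, t) ∈ U

theorem mem_sel {d : ℕ} {F : Polynomial (MvPolynomial (Fin d) ℂ)} (hF : F.Monic)
    {U : Set ((Fin d → ℂ) × ℂ)} {y : Fin d → ℂ} {t : ℂ} :
    t ∈ sel F U y ↔ (fib F y).eval t = 0 ∧ (y, t) ∈ U := by
  simp [sel, (fib_monic hF y).ne_zero]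

theorem card_roots_fib {d : ℕ} {F : Polynomial (MvPolynomial (Fin d) ℂ)} (hF : F.Monic)
    (y : Fin d → ℂ) : (fib F y).roots.toFinset.card ≤ F.natDegree := by
  refine (Multiset.toFinset_card_le _).trans ((Polynomial.card_roots' _).trans ?_)
  rw [hF.natDegree_map]

theorem nodup_fib {d : ℕ} {F : Polynomial (MvPolynomial (Fin d) ℂ)} (hF : F.Monic)
    (y : Fin d → ℂ)
    (hsep : ∀ t, (fib F y).eval t = 0 → (fib F y).derivative.eval t ≠ 0) :
    (fib F y).roots.Nodup := by
  rw [Multiset.nodup_iff_count_le_one]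
  intro t
  rw [Polynomial.count_roots]
  by_contra hlt
  push Not at hlt
  have := (Polynomial.one_lt_rootMultiplicity_iff_isRoot (fib_monic hF y).ne_zero).1 hlt
  exact hsep t this.1 this.2

theorem card_roots_fib_eq {d : ℕ} {F : Polynomial (MvPolynomial (Fin d) ℂ)} (hF : F.Monic)
    (y : Fin d → ℂ)
    (hsep : ∀ t, (fib F y).eval t = 0 → (fib F y).derivative.eval t ≠ 0) :
    (fib F y).roots.toFinset.card = F.natDegree := by
  rw [Multiset.toFinset_card_of_nodup (nodup_fib hF y hsep),
    (IsAlgClosed.splits (fib F y)).natDegree_eq_card_roots.symm, hF.natDegree_map]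

theorem eval_fib_eq_prod {d : ℕ} {F : Polynomial (MvPolynomial (Fin d) ℂ)} (hF : F.Monic)
    (y : Fin d → ℂ) (τ : ℂ)
    (hsep : ∀ t, (fib F y).eval t = 0 → (fib F y).derivative.eval t ≠ 0) :
    (fib F y).eval τ = ∏ t ∈ (fib F y).roots.toFinset, (τ - t) := by
  conv_lhs => rw [(IsAlgClosed.splits (fib F y)).eq_prod_roots_of_monic (fib_monic hF y)]
  rw [Polynomial.eval_multiset_prod, Multiset.map_map, Finset.prod_multiset_map_count]
  refine Finset.prod_congr rfl fun t ht => ?_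
  rw [Multiset.count_eq_one_of_mem (nodup_fib hF y hsep) (by simpa using ht)]
  simp

theorem sel_local {d : ℕ} {F : Polynomial (MvPolynomial (Fin d) ℂ)} (hF : F.Monic)
    {U V : Set ((Fin d → ℂ) × ℂ)} (hU : IsOpen U) (hV : IsOpen V) (y₀ : Fin d → ℂ)
    (hsep : ∀ t, (fib F y₀).eval t = 0 → (fib F y₀).derivative.eval t ≠ 0)
    (hUV : ∀ᶠ y in 𝓝 y₀, ∀ t, (fib F y).eval t = 0 →
      ((y, t) ∈ U ∨ (y, t) ∈ V) ∧ ¬ ((y, t) ∈ U ∧ (y, t) ∈ V)) :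
    ∃ r : ℂ → (Fin d → ℂ) → ℂ, (∀ t ∈ sel F U y₀, DifferentiableAt ℂ (r t) y₀) ∧
      ∀ᶠ y in 𝓝 y₀, sel F U y = (sel F U y₀).image (fun t => r t y) ∧
        Set.InjOn (fun t => r t y) (sel F U y₀) := by
  classical
  have hex : ∀ t, ∃ r : (Fin d → ℂ) → ℂ, (fib F y₀).eval t = 0 → DifferentiableAt ℂ r y₀ ∧
      r y₀ = t ∧ ∀ᶠ y in 𝓝 y₀, (fib F y).eval (r y) = 0 := by
    intro t
    by_cases ht : (fib F y₀).eval t = 0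
    · obtain ⟨r, hr⟩ := fib_implicit F y₀ t ht (hsep t ht)
      exact ⟨r, fun _ => hr⟩
    · exact ⟨0, fun h => absurd h ht⟩
  choose r hr using hex
  set R := (fib F y₀).roots.toFinset with hR
  have hmem : ∀ t, t ∈ R ↔ (fib F y₀).eval t = 0 := by
    intro t; simp [hR, (fib_monic hF y₀).ne_zero]
  refine ⟨r, fun t ht => (hr t ((mem_sel hF).1 ht).1).1, ?_⟩
  have hcont : ∀ t ∈ R, ContinuousAt (r t) y₀ := fun t ht =>
    (hr t ((hmem t).1 ht)).1.continuousAt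
  have e1 : ∀ᶠ y in 𝓝 y₀, ∀ t ∈ R, (fib F y).eval (r t y) = 0 := by
    rw [Finset.eventually_all]
    exact fun t ht => (hr t ((hmem t).1 ht)).2.2
  have e2 : ∀ᶠ y in 𝓝 y₀, ∀ t ∈ R, ∀ t' ∈ R, t ≠ t' → r t y ≠ r t' y := by
    rw [Finset.eventually_all]
    intro t ht
    rw [Finset.eventually_all]
    intro t' ht'
    by_cases hne : t = t'
    · simp [hne]
    · have h3 : r t y₀ ≠ r t' y₀ := by
        rw [(hr t ((hmem t).1 ht)).2.1, (hr t' ((hmem t').1 ht')).2.1]; exact hne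
      have := ((hcont t ht).sub (hcont t' ht')).eventually_ne (sub_ne_zero.2 h3)
      filter_upwards [this] with y hy _ using sub_ne_zero.1 hy
  have e3 : ∀ᶠ y in 𝓝 y₀, ∀ t ∈ R, (y₀, t) ∈ U → (y, r t y) ∈ U := by
    rw [Finset.eventually_all]
    intro t ht
    by_cases h : (y₀, t) ∈ U
    · have hc : ContinuousAt (fun y => (y, r t y)) y₀ := continuousAt_id.prodMk (hcont t ht)
      have := hc.eventually_mem (by
        rw [(hr t ((hmem t).1 ht)).2.1]; exact hU.mem_nhds h)
      filter_upwards [this] with y hy _ using hy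
    · simp [h]
  have e4 : ∀ᶠ y in 𝓝 y₀, ∀ t ∈ R, (y₀, t) ∈ V → (y, r t y) ∈ V := by
    rw [Finset.eventually_all]
    intro t ht
    by_cases h : (y₀, t) ∈ V
    · have hc : ContinuousAt (fun y => (y, r t y)) y₀ := continuousAt_id.prodMk (hcont t ht)
      have := hc.eventually_mem (by
        rw [(hr t ((hmem t).1 ht)).2.1]; exact hV.mem_nhds h)
      filter_upwards [this] with y hy _ using hy
    · simp [h]
  have hUV0 := hUV.self_of_nhds
  filter_upwards [e1, e2, e3, e4, hUV] with y h1 h2 h3 h4 h5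
  have hsub : ∀ t, t ∈ sel F U y₀ → t ∈ R := fun t ht => (hmem t).2 ((mem_sel hF).1 ht).1
  have hinj : Set.InjOn (fun t => r t y) R := by
    intro t ht t' ht' h
    by_contra hne
    exact h2 t ht t' ht' hne h
  have hall : R.image (fun t => r t y) = (fib F y).roots.toFinset := by
    refine Finset.eq_of_subset_of_card_le ?_ ?_
    · intro s hs
      obtain ⟨t, ht, rfl⟩ := Finset.mem_image.1 hs
      simp [(fib_monic hF y).ne_zero, h1 t ht]
    · rw [Finset.card_image_of_injOn hinj, hR, card_roots_fib_eq hF y₀ hsep]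
      exact card_roots_fib hF y
  refine ⟨?_, hinj.mono fun t ht => hsub t ht⟩
  ext s
  constructor
  · intro hs
    rw [mem_sel hF] at hs
    have : s ∈ R.image (fun t => r t y) := by
      rw [hall]; simp [(fib_monic hF y).ne_zero, hs.1]
    obtain ⟨t, ht, rfl⟩ := Finset.mem_image.1 this
    refine Finset.mem_image.2 ⟨t, ?_, rfl⟩
    rw [mem_sel hF]
    have ht' := (hmem t).1 ht
    refine ⟨ht', ?_⟩
    rcases (hUV0 t ht').1 with h | h
    · exact h
    · exact absurd ⟨hs.2, h4 t ht h⟩ (h5 _ hs.1).2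
  · intro hs
    obtain ⟨t, ht, rfl⟩ := Finset.mem_image.1 hs
    rw [mem_sel hF]
    exact ⟨h1 t (hsub t ht), h3 t (hsub t ht) ((mem_sel hF).1 ht).2⟩

theorem prod_sel_bound {d : ℕ} {F : Polynomial (MvPolynomial (Fin d) ℂ)} (hF : F.Monic)
    (U : Set ((Fin d → ℂ) × ℂ)) (y : Fin d → ℂ) (τ : ℂ) :
    ‖∏ t ∈ sel F U y, (τ - t)‖ ≤ (1 + ‖τ‖ + rootBd F y) ^ F.natDegree := by
  classical
  rw [norm_prod]
  have h0 := rootBd_nonneg F y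
  have hcard : (sel F U y).card ≤ F.natDegree :=
    (Finset.card_filter_le _ _).trans (card_roots_fib hF y)
  calc ∏ t ∈ sel F U y, ‖τ - t‖ ≤ ∏ t ∈ sel F U y, (1 + ‖τ‖ + rootBd F y) := by
        refine Finset.prod_le_prod (fun _ _ => norm_nonneg _) fun t ht => ?_
        have := fib_root_bound hF y t ((mem_sel hF).1 ht).1
        linarith [norm_sub_le τ t]
    _ = (1 + ‖τ‖ + rootBd F y) ^ (sel F U y).card := by rw [Finset.prod_const]
    _ ≤ _ := pow_le_pow_right₀ (by linarith [norm_nonneg τ]) hcard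

theorem diff_prod {E ι : Type*} [NormedAddCommGroup E] [NormedSpace ℂ E] (s : Finset ι)
    (f : ι → E → ℂ) (x : E) (h : ∀ i ∈ s, DifferentiableAt ℂ (f i) x) :
    DifferentiableAt ℂ (fun y => ∏ i ∈ s, f i y) x := by
  classical
  induction s using Finset.induction_on with
  | empty => simp
  | insert a s ha ih =>
    simp only [Finset.prod_insert ha]
    exact (h a (by simp)).mul (ih fun i hi => h i (by simp [hi]))

theorem selfun_diff {d : ℕ} {F : Polynomial (MvPolynomial (Fin d) ℂ)} (hF : F.Monic)
    (δ : MvPolynomial (Fin d) ℂ)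
    {U V : Set ((Fin d → ℂ) × ℂ)} (hU : IsOpen U) (hV : IsOpen V)
    (hsep : ∀ y, MvPolynomial.eval y δ ≠ 0 →
      ∀ t, (fib F y).eval t = 0 → (fib F y).derivative.eval t ≠ 0)
    (hUV : ∀ y, MvPolynomial.eval y δ ≠ 0 → ∀ t, (fib F y).eval t = 0 →
      ((y, t) ∈ U ∨ (y, t) ∈ V) ∧ ¬ ((y, t) ∈ U ∧ (y, t) ∈ V)) (τ : ℂ) :
    Differentiable ℂ (fun y => MvPolynomial.eval y δ ^ 2 * ∏ t ∈ sel F U y, (τ - t)) := by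
  classical
  intro y₀
  have hδd : DifferentiableAt ℂ (fun y => MvPolynomial.eval y δ) y₀ :=
    (eval_contDiff δ).differentiable one_ne_zero y₀
  by_cases h0 : MvPolynomial.eval y₀ δ = 0
  · have hO : (fun y => MvPolynomial.eval y δ) =O[𝓝 y₀] fun y => y - y₀ := by
      simpa [h0] using hδd.isBigO_sub
    have hB : (fun y => ∏ t ∈ sel F U y, (τ - t)) =O[𝓝 y₀] fun _ => (1 : ℝ) := by
      have hc : ContinuousAt (fun y => (1 + ‖τ‖ + rootBd F y) ^ F.natDegree) y₀ :=
        ((continuous_const.add (rootBd_cont F)).pow _).continuousAt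
      refine Asymptotics.IsBigO.trans ?_ (hc.isBigO_one ℝ)
      refine Asymptotics.IsBigO.of_bound 1 (Eventually.of_forall fun y => ?_)
      rw [one_mul]
      exact (prod_sel_bound hF U y τ).trans (le_abs_self _)
    have h2 : (fun y => MvPolynomial.eval y δ ^ 2 * ∏ t ∈ sel F U y, (τ - t)) =O[𝓝 y₀]
        fun y => ‖y - y₀‖ ^ 2 := by
      have := ((hO.norm_right.pow 2).mul hB)
      simpa using this
    have : HasFDerivAt (fun y => MvPolynomial.eval y δ ^ 2 * ∏ t ∈ sel F U y, (τ - t))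
        (0 : (Fin d → ℂ) →L[ℂ] ℂ) y₀ := by
      rw [hasFDerivAt_iff_isLittleO]
      simp only [h0, zero_apply, sub_zero]
      simp only [ne_eq, OfNat.ofNat_ne_zero, not_false_eq_true, zero_pow, zero_mul, sub_zero]
      refine h2.trans_isLittleO ?_
      exact Asymptotics.isLittleO_pow_sub_sub y₀ one_lt_two
    exact this.differentiableAt
  · have hne : ∀ᶠ y in 𝓝 y₀, MvPolynomial.eval y δ ≠ 0 :=
      hδd.continuousAt.eventually_ne h0
    obtain ⟨r, hr, he⟩ := sel_local hF hU hV y₀ (hsep y₀ h0) (hne.mono hUV)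
    refine (hδd.pow 2).mul ?_
    have : DifferentiableAt ℂ (fun y => ∏ t ∈ sel F U y₀, (τ - r t y)) y₀ := by
      exact diff_prod _ _ _ fun t ht => (hr t ht).const_sub τ
    refine this.congr_of_eventuallyEq ?_
    filter_upwards [he] with y hy
    rw [hy.1, Finset.prod_image hy.2]

theorem selfun_poly {d : ℕ} {F : Polynomial (MvPolynomial (Fin d) ℂ)} (hF : F.Monic)
    (δ : MvPolynomial (Fin d) ℂ)
    {U V : Set ((Fin d → ℂ) × ℂ)} (hU : IsOpen U) (hV : IsOpen V)
    (hsep : ∀ y, MvPolynomial.eval y δ ≠ 0 →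
      ∀ t, (fib F y).eval t = 0 → (fib F y).derivative.eval t ≠ 0)
    (hUV : ∀ y, MvPolynomial.eval y δ ≠ 0 → ∀ t, (fib F y).eval t = 0 →
      ((y, t) ∈ U ∨ (y, t) ∈ V) ∧ ¬ ((y, t) ∈ U ∧ (y, t) ∈ V)) :
    ∃ p : MvPolynomial (Fin (d+1)) ℂ, ∀ y τ, MvPolynomial.eval y δ ^ 2 *
      ∏ t ∈ sel F U y, (τ - t) = MvPolynomial.eval (Fin.cons τ y) p := by
  set H : (Fin (d+1) → ℂ) → ℂ := fun z => MvPolynomial.eval (Fin.tail z) δ ^ 2 *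
      ∏ t ∈ sel F U (Fin.tail z), (z 0 - t) with hH
  have hg : PolyGrowth (fun z => ‖H z‖) := by
    have h1 : PolyGrowth (fun z : Fin (d+1) → ℂ => ‖MvPolynomial.eval (Fin.tail z) δ‖) :=
      (PolyGrowth.eval δ).comp_tail
    have h2 : PolyGrowth (fun z : Fin (d+1) → ℂ => rootBd F (Fin.tail z)) :=
      (PolyGrowth.rootBd F).comp_tail
    have h3 : PolyGrowth (fun z : Fin (d+1) → ℂ => ‖z 0‖) := by
      simpa using PolyGrowth.eval (MvPolynomial.X (0 : Fin (d+1)))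
    have h4 := (((PolyGrowth.const 1).add h3).add h2).pow
      (fun z => by have := rootBd_nonneg F (Fin.tail z); positivity) F.natDegree
    refine ((h1.pow (fun _ => norm_nonneg _) 2).mul h4
      (fun z => by have := rootBd_nonneg F (Fin.tail z); positivity)).mono fun z => ?_
    rw [hH, norm_mul, norm_pow]
    gcongr
    exact prod_sel_bound hF U _ _
  obtain ⟨K, M, -, hM⟩ := hg
  obtain ⟨p, hp⟩ := sep_entire_growth_poly M (d+1) H (by
    intro z i
    refine Fin.cases ?_ (fun j => ?_) i
    · have h1 : ∀ s : ℂ, Fin.tail (Function.update z 0 s) = Fin.tail z := fun s =>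
        Fin.tail_update_zero _ _
      simp only [hH, h1, Function.update_self]
      refine (differentiable_const _).mul ?_
      refine Differentiable.fun_finsetProd fun t _ => ?_
      exact differentiable_id.sub_const t
    · have h1 : ∀ s : ℂ, Fin.tail (Function.update z j.succ s) =
          Function.update (Fin.tail z) j s := fun s => Fin.tail_update_succ _ _ _
      have h2 : ∀ s : ℂ, Function.update z j.succ s 0 = z 0 := fun s => by
        rw [Function.update_of_ne (Fin.succ_ne_zero j).symm]
      simp only [hH, h1, h2]
      refine (selfun_diff hF δ hU hV hsep hUV (z 0)).comp
        (f := fun s : ℂ => Function.update (Fin.tail z) j s) ?_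
      intro s
      exact (hasFDerivAt_update (Fin.tail z) s).differentiableAt) K hM
  refine ⟨p, fun y τ => ?_⟩
  rw [← hp]
  simp [hH]

/-- The unramified part of an irreducible hypersurface monic in one variable is connected. -/
theorem hypersurface_preconnected {d : ℕ} {F : Polynomial (MvPolynomial (Fin d) ℂ)}
    (hF : F.Monic) (hpr : Prime F) (δ : MvPolynomial (Fin d) ℂ)
    (hsep : ∀ y, MvPolynomial.eval y δ ≠ 0 →
      ∀ t, (fib F y).eval t = 0 → (fib F y).derivative.eval t ≠ 0) :
    IsPreconnected {z : (Fin d → ℂ) × ℂ | MvPolynomial.eval z.1 δ ≠ 0 ∧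
      (fib F z.1).eval z.2 = 0} := by
  classical
  rw [isPreconnected_iff_subset_of_disjoint]
  intro U V hU hV hcov hdis
  have hUV : ∀ y, MvPolynomial.eval y δ ≠ 0 → ∀ t, (fib F y).eval t = 0 →
      ((y, t) ∈ U ∨ (y, t) ∈ V) ∧ ¬ ((y, t) ∈ U ∧ (y, t) ∈ V) := by
    intro y hy t ht
    refine ⟨hcov (show (y, t) ∈ _ from ⟨hy, ht⟩), fun h => ?_⟩
    have : (y, t) ∈ (∅ : Set ((Fin d → ℂ) × ℂ)) := by
      rw [← hdis]; exact ⟨⟨hy, ht⟩, h⟩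
    exact this
  obtain ⟨p, hp⟩ := selfun_poly hF δ hU hV hsep hUV
  obtain ⟨q, hq⟩ := selfun_poly hF δ hV hU hsep (fun y hy t ht => by
    obtain ⟨h1, h2⟩ := hUV y hy t ht
    exact ⟨h1.symm, fun h => h2 h.symm⟩)
  set G := (MvPolynomial.finSuccEquiv ℂ d).symm F with hG
  have hGe : ∀ y τ, MvPolynomial.eval (Fin.cons τ y) G = (fib F y).eval τ := by
    intro y τ
    rw [MvPolynomial.eval_eq_eval_mv_eval', hG, AlgEquiv.apply_symm_apply]
  have hGp : Prime G := by
    rw [hG]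
    exact (MulEquiv.prime_iff (MvPolynomial.finSuccEquiv ℂ d).symm.toMulEquiv).2 hpr
  have key : p * q = G * (MvPolynomial.rename Fin.succ δ) ^ 4 := by
    refine MvPolynomial.funext fun z => ?_
    rw [← Fin.cons_self_tail z]
    set y := Fin.tail z
    set τ := z 0
    rw [map_mul, map_mul, ← hp, ← hq, hGe, map_pow, MvPolynomial.eval_rename]
    have hy : (Fin.cons τ y : Fin (d+1) → ℂ) ∘ Fin.succ = y := by ext; simp
    rw [hy]
    by_cases h0 : MvPolynomial.eval y δ = 0
    · simp [h0]
    · have hd : Disjoint (sel F U y) (sel F V y) := by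
        rw [Finset.disjoint_left]
        intro t h1 h2
        exact (hUV y h0 t ((mem_sel hF).1 h1).1).2 ⟨((mem_sel hF).1 h1).2, ((mem_sel hF).1 h2).2⟩
      have hu : sel F U y ∪ sel F V y = (fib F y).roots.toFinset := by
        ext t
        rw [Finset.mem_union, mem_sel hF, mem_sel hF]
        simp only [Multiset.mem_toFinset, Polynomial.mem_roots (fib_monic hF y).ne_zero,
          Polynomial.IsRoot.def]
        constructor
        · rintro (h | h) <;> exact h.1
        · intro h
          rcases (hUV y h0 t h).1 with h' | h'
          · exact Or.inl ⟨h, h'⟩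
          · exact Or.inr ⟨h, h'⟩
      rw [eval_fib_eq_prod hF y τ (hsep y h0), ← hu, Finset.prod_union hd]
      ring
  have fin : ∀ (W : Set ((Fin d → ℂ) × ℂ)) (p : MvPolynomial (Fin (d+1)) ℂ),
      (∀ y τ, MvPolynomial.eval y δ ^ 2 *
        ∏ t ∈ sel F W y, (τ - t) = MvPolynomial.eval (Fin.cons τ y) p) → G ∣ p →
      {z : (Fin d → ℂ) × ℂ | MvPolynomial.eval z.1 δ ≠ 0 ∧ (fib F z.1).eval z.2 = 0} ⊆ W := by
    rintro W p hp ⟨c, rfl⟩ ⟨y, t⟩ ⟨hy, ht⟩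
    have := hp y t
    rw [map_mul, hGe] at this
    simp only at hy ht
    rw [ht, zero_mul] at this
    have := (mul_eq_zero.1 this).resolve_left (pow_ne_zero 2 hy)
    rw [Finset.prod_eq_zero_iff] at this
    obtain ⟨s, hs, hts⟩ := this
    rw [sub_eq_zero] at hts
    rw [hts]
    exact ((mem_sel hF).1 hs).2
  rcases hGp.dvd_or_dvd (Dvd.intro _ key.symm) with h | h
  · exact Or.inl (fin U p hp h)
  · exact Or.inr (fin V q hq h)

section alg
variable {d : ℕ} {R : Type*} [CommRing R] [IsDomain R] [Algebra ℂ R]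
  [Algebra (MvPolynomial (Fin d) ℂ) R] [IsScalarTower ℂ (MvPolynomial (Fin d) ℂ) R]

theorem chi_aeval {χ : R →ₐ[ℂ] ℂ} {y : Fin d → ℂ}
    (hχ : ∀ a, χ (algebraMap (MvPolynomial (Fin d) ℂ) R a) = MvPolynomial.eval y a)
    (h : R) (N : Polynomial (MvPolynomial (Fin d) ℂ)) :
    χ (Polynomial.aeval h N) = (fib N y).eval (χ h) := by
  rw [Polynomial.aeval_def, Polynomial.eval_map, Polynomial.eval₂_eq_sum_range,
    Polynomial.eval₂_eq_sum_range]
  simp [hχ]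

theorem chi_minpoly {χ : R →ₐ[ℂ] ℂ} {y : Fin d → ℂ}
    (hχ : ∀ a, χ (algebraMap (MvPolynomial (Fin d) ℂ) R a) = MvPolynomial.eval y a)
    (h : R) : (fib (minpoly (MvPolynomial (Fin d) ℂ) h) y).eval (χ h) = 0 := by
  rw [← chi_aeval hχ, minpoly.aeval, map_zero]

theorem lying_over [Algebra.IsIntegral (MvPolynomial (Fin d) ℂ) R]
    [FaithfulSMul (MvPolynomial (Fin d) ℂ) R] (h : R) (y : Fin d → ℂ) (t : ℂ)
    (ht : (fib (minpoly (MvPolynomial (Fin d) ℂ) h) y).eval t = 0) :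
    ∃ χ : R →ₐ[ℂ] ℂ, (∀ a, χ (algebraMap (MvPolynomial (Fin d) ℂ) R a) = MvPolynomial.eval y a) ∧
      χ h = t := by
  let A := MvPolynomial (Fin d) ℂ
  have hInteg : IsIntegral A h := Algebra.IsIntegral.isIntegral h
  let ψ : Polynomial A →ₐ[A] R := Polynomial.aeval h
  have hker : RingHom.ker ψ = Ideal.span {minpoly A h} := by
    exact minpoly.ker_eval hInteg
  let e : Polynomial A →+* ℂ := Polynomial.eval₂RingHom (MvPolynomial.eval y) t
  letI : Algebra (Polynomial A) R := ψ.toRingHom.toAlgebra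
  have hψ : algebraMap (Polynomial A) R = ψ.toRingHom := rfl
  haveI : IsScalarTower A (Polynomial A) R := IsScalarTower.of_algebraMap_eq fun a => by
    rw [hψ]; exact (ψ.commutes a).symm
  haveI : Algebra.IsIntegral (Polynomial A) R := Algebra.IsIntegral.tower_top A
  have hJ : (RingHom.ker e).IsPrime := RingHom.ker_isPrime e
  obtain ⟨Q, -, hQp, hQ⟩ := Ideal.exists_ideal_over_prime_of_isIntegral (R := Polynomial A) (S := R)
    (RingHom.ker e) (⊥ : Ideal R) (by
      intro a ha
      have h1 : a ∈ RingHom.ker ψ := by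
        rw [Ideal.mem_comap, Ideal.mem_bot, hψ] at ha
        exact ha
      rw [hker, Ideal.mem_span_singleton] at h1
      obtain ⟨c, rfl⟩ := h1
      rw [RingHom.mem_ker, map_mul]
      have : e (minpoly A h) = 0 := by
        rw [← ht, Polynomial.eval_map]; rfl
      rw [this, zero_mul])
  have hmem : ∀ a : Polynomial A, e a = 0 → ψ a ∈ Q := by
    intro a ha
    have : a ∈ Ideal.comap (algebraMap (Polynomial A) R) Q := by
      rw [hQ]; exact ha
    exact this
  have hfac : ∀ a : Polynomial A, Ideal.Quotient.mk Q (ψ a) = algebraMap ℂ (R ⧸ Q) (e a) := by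
    intro a
    have h1 := hmem (a - Polynomial.C (MvPolynomial.C (e a))) (by
      rw [map_sub, sub_eq_zero]
      have h3 : e (Polynomial.C (MvPolynomial.C (e a))) =
          MvPolynomial.eval y (MvPolynomial.C (e a)) := Polynomial.eval₂_C _ _
      rw [h3, MvPolynomial.eval_C])
    rw [map_sub] at h1
    change Ideal.Quotient.mk Q (ψ a) = Ideal.Quotient.mk Q (algebraMap ℂ R (e a))
    rw [Ideal.Quotient.eq]
    have h2 : ψ (Polynomial.C (MvPolynomial.C (e a))) = algebraMap ℂ R (e a) := by
      simp only [ψ, Polynomial.aeval_C]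
      exact (IsScalarTower.algebraMap_apply ℂ A R (e a)).symm
    rwa [h2] at h1
  have hi2 : (algebraMap ℂ (R ⧸ Q)).IsIntegral := by
    have h1 : ((Ideal.Quotient.mk Q).comp ψ.toRingHom).IsIntegral :=
      RingHom.IsIntegral.trans _ _ (algebraMap_isIntegral_iff.2 ‹_›)
        (RingHom.isIntegral_of_surjective _ Ideal.Quotient.mk_surjective)
    have h2 : (Ideal.Quotient.mk Q).comp ψ.toRingHom = (algebraMap ℂ (R ⧸ Q)).comp e := by
      exact RingHom.ext fun a => hfac a
    rw [h2] at h1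
    exact RingHom.IsIntegral.tower_top _ _ h1
  have hbij := IsAlgClosed.ringHom_bijective_of_isIntegral (algebraMap ℂ (R ⧸ Q)) hi2
  let E : ℂ ≃ₐ[ℂ] (R ⧸ Q) := AlgEquiv.ofBijective (Algebra.ofId ℂ (R ⧸ Q)) hbij
  have hE : ∀ a : Polynomial A, E.symm (Ideal.Quotient.mk Q (ψ a)) = e a := by
    intro a
    rw [hfac, AlgEquiv.symm_apply_eq]
    rfl
  refine ⟨(E.symm : (R ⧸ Q) →ₐ[ℂ] ℂ).comp (Ideal.Quotient.mkₐ ℂ Q), fun a => ?_, ?_⟩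
  · have := hE (Polynomial.C a)
    simpa [ψ, e] using this
  · have := hE Polynomial.X
    simpa [ψ, e] using this

theorem exists_dvd_algebraMap [Algebra.IsIntegral (MvPolynomial (Fin d) ℂ) R]
    (r : R) (hr : r ≠ 0) :
    ∃ g : MvPolynomial (Fin d) ℂ, g ≠ 0 ∧ r ∣ algebraMap (MvPolynomial (Fin d) ℂ) R g := 
  (Algebra.IsAlgebraic.isAlgebraic (R := MvPolynomial (Fin d) ℂ) r).exists_nonzero_dvd
    (mem_nonZeroDivisors_of_ne_zero hr)

theorem derivative_ne [Algebra.IsIntegral (MvPolynomial (Fin d) ℂ) R]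
    [FaithfulSMul (MvPolynomial (Fin d) ℂ) R] (f : R) :
    Polynomial.aeval f (minpoly (MvPolynomial (Fin d) ℂ) f).derivative ≠ 0 := by
  intro h
  have hInteg : IsIntegral (MvPolynomial (Fin d) ℂ) f := Algebra.IsIntegral.isIntegral f
  have hdeg := minpoly.natDegree_pos hInteg
  have h1 : (minpoly (MvPolynomial (Fin d) ℂ) f).derivative ≠ 0 := by
    intro h0
    have := Polynomial.natDegree_eq_zero_of_derivative_eq_zero h0
    omega
  have h2 := minpoly.isIntegrallyClosed_dvd hInteg h
  have h3 := Polynomial.natDegree_le_of_dvd h2 h1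
  have h4 := Polynomial.natDegree_derivative_lt hdeg.ne'
  omega

theorem exists_primitive [Module.Finite (MvPolynomial (Fin d) ℂ) R]
    [FaithfulSMul (MvPolynomial (Fin d) ℂ) R] :
    ∃ f : R, ∀ r : R, ∃ c : MvPolynomial (Fin d) ℂ, c ≠ 0 ∧
      ∃ N : Polynomial (MvPolynomial (Fin d) ℂ),
        algebraMap (MvPolynomial (Fin d) ℂ) R c * r = Polynomial.aeval f N := by
  let A := MvPolynomial (Fin d) ℂ
  let K := FractionRing A
  let L := FractionRing R
  letI : Algebra K L := FractionRing.liftAlgebra A L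
  haveI : IsScalarTower A K L := FractionRing.isScalarTower_liftAlgebra A L
  haveI : CharZero K := charZero_of_injective_algebraMap (IsFractionRing.injective A K)
  haveI : IsLocalization (Algebra.algebraMapSubmonoid R (nonZeroDivisors A)) L := inferInstance
  haveI : FiniteDimensional K L := Module.Finite.of_isLocalization A R (nonZeroDivisors A)
  obtain ⟨α, hα⟩ := Field.exists_primitive_element K L
  obtain ⟨a, b, hb, rfl⟩ := IsFractionRing.div_surjective (A := R) α
  obtain ⟨g, hg, b', hb'⟩ := exists_dvd_algebraMap (d := d) b (nonZeroDivisors.ne_zero hb)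
  refine ⟨a * b', fun r => ?_⟩
  have inj : Function.Injective (algebraMap R L) := IsFractionRing.injective R L
  have hb0 : algebraMap R L b ≠ 0 := fun h => nonZeroDivisors.ne_zero hb (inj (by simpa using h))
  have hgK : algebraMap A K g ≠ 0 := fun h =>
    hg (IsFractionRing.injective A K (by simpa using h))
  have hgL : algebraMap K L (algebraMap A K g) = algebraMap R L b * algebraMap R L b' := by
    rw [← map_mul, ← hb', ← IsScalarTower.algebraMap_apply A K L,
      ← IsScalarTower.algebraMap_apply A R L]
  have hprod : algebraMap R L (a * b') =
      algebraMap K L (algebraMap A K g) * (algebraMap R L a / algebraMap R L b) := by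
    rw [hgL, map_mul, mul_div_assoc', eq_div_iff hb0]; ring
  have hr : algebraMap R L r ∈ IntermediateField.adjoin K {algebraMap R L (a * b')} := by
    have : algebraMap R L a / algebraMap R L b ∈
        IntermediateField.adjoin K {algebraMap R L (a * b')} := by
      have h1 : algebraMap R L (a * b') ∈ IntermediateField.adjoin K {algebraMap R L (a * b')} :=
        IntermediateField.mem_adjoin_simple_self K _
      have h2 : algebraMap R L a / algebraMap R L b =
          (algebraMap K L (algebraMap A K g))⁻¹ * algebraMap R L (a * b') := by
        rw [hprod, inv_mul_cancel_left₀ (by simpa using hgK)]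
      rw [h2]
      exact mul_mem (inv_mem (IntermediateField.algebraMap_mem _ _)) h1
    have h3 : (⊤ : IntermediateField K L) ≤ IntermediateField.adjoin K {algebraMap R L (a * b')} := by
      rw [← hα, IntermediateField.adjoin_simple_le_iff]
      exact this
    exact h3 trivial
  rw [← IntermediateField.mem_toSubalgebra, IntermediateField.adjoin_simple_toSubalgebra_of_isAlgebraic (Algebra.IsAlgebraic.isAlgebraic _), Algebra.adjoin_singleton_eq_range_aeval] at hr
  obtain ⟨p, hp⟩ := hr
  obtain ⟨c, hcm, hc⟩ := IsLocalization.integerNormalization_spec (nonZeroDivisors A) p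
  refine ⟨c, nonZeroDivisors.ne_zero hcm, IsLocalization.integerNormalization (nonZeroDivisors A) p, ?_⟩
  apply inj
  rw [map_mul, ← IsScalarTower.algebraMap_apply, ← hp, ← Polynomial.aeval_algebraMap_apply,
    ← Polynomial.aeval_map_algebraMap K, hc]
  change _ * Polynomial.aeval _ p = _
  rw [← Algebra.smul_def, ← IsScalarTower.algebraMap_smul K c p, map_smul,
    IsScalarTower.algebraMap_smul]
end alg

section geo
variable {d : ℕ} {R : Type*} [CommRing R] [IsDomain R] [Algebra ℂ R]
  [Algebra (MvPolynomial (Fin d) ℂ) R] [IsScalarTower ℂ (MvPolynomial (Fin d) ℂ) R]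

/-- `χ` lies over the point `y`. -/
def LiesOver (χ : R →ₐ[ℂ] ℂ) (y : Fin d → ℂ) : Prop :=
  ∀ a, χ (algebraMap (MvPolynomial (Fin d) ℂ) R a) = MvPolynomial.eval y a

/-- Coordinates of the point defined by `χ`. -/
noncomputable def ptOf {ι : Type*} (φ : MvPolynomial ι ℂ →ₐ[ℂ] R) (χ : R →ₐ[ℂ] ℂ) : ι → ℂ :=
  fun j => χ (φ (MvPolynomial.X j))

theorem chi_phi {ι : Type*} (φ : MvPolynomial ι ℂ →ₐ[ℂ] R) (χ : R →ₐ[ℂ] ℂ)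
    (p : MvPolynomial ι ℂ) : χ (φ p) = MvPolynomial.eval (ptOf φ χ) p := by
  have : χ.comp φ = MvPolynomial.aeval (ptOf φ χ) := by
    apply MvPolynomial.algHom_ext
    intro j
    simp [ptOf]
  have h := DFunLike.congr_fun this p
  rw [MvPolynomial.aeval_eq_eval] at h
  exact h

theorem generic_connected {ι : Type*} [Fintype ι] [Module.Finite (MvPolynomial (Fin d) ℂ) R]
    [FaithfulSMul (MvPolynomial (Fin d) ℂ) R] (φ : MvPolynomial ι ℂ →ₐ[ℂ] R) (q : R) (hq : q ≠ 0) :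
    ∃ δ : MvPolynomial (Fin d) ℂ, δ ≠ 0 ∧
      (∀ χ : R →ₐ[ℂ] ℂ, ∀ y, LiesOver χ y → MvPolynomial.eval y δ ≠ 0 → χ q ≠ 0) ∧
      IsPreconnected {x : ι → ℂ | ∃ χ : R →ₐ[ℂ] ℂ, ∃ y, LiesOver χ y ∧
        MvPolynomial.eval y δ ≠ 0 ∧ ptOf φ χ = x} := by
  classical
  obtain ⟨f, hf⟩ := exists_primitive (d := d) (R := R)
  choose c hc N hN using fun j : ι => hf (φ (MvPolynomial.X j))
  have hInteg : IsIntegral (MvPolynomial (Fin d) ℂ) f := Algebra.IsIntegral.isIntegral f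
  set F := minpoly (MvPolynomial (Fin d) ℂ) f with hF
  have hFm : F.Monic := minpoly.monic hInteg
  have hFp : Prime F := minpoly.prime_of_isIntegrallyClosed hInteg
  obtain ⟨g1, hg1, h1⟩ := exists_dvd_algebraMap (d := d) _ (derivative_ne (d := d) f)
  obtain ⟨g2, hg2, h2⟩ := exists_dvd_algebraMap (d := d) q hq
  have key : ∀ (r : R) (g : MvPolynomial (Fin d) ℂ), r ∣ algebraMap _ R g →
      ∀ χ : R →ₐ[ℂ] ℂ, ∀ y, LiesOver χ y → MvPolynomial.eval y g ≠ 0 → χ r ≠ 0 := by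
    rintro r g ⟨s, hs⟩ χ y hχ hy h0
    apply hy
    rw [← hχ, hs, map_mul, h0, zero_mul]
  refine ⟨g1 * g2 * ∏ j, c j, ?_, ?_, ?_⟩
  · exact mul_ne_zero (mul_ne_zero hg1 hg2) (Finset.prod_ne_zero_iff.2 fun j _ => hc j)
  · intro χ y hχ hy
    rw [map_mul, map_mul] at hy
    exact key q g2 h2 χ y hχ (right_ne_zero_of_mul (left_ne_zero_of_mul hy))
  · set δ := g1 * g2 * ∏ j, c j with hδ
    have hδ1 : ∀ y, MvPolynomial.eval y δ ≠ 0 → MvPolynomial.eval y g1 ≠ 0 := by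
      intro y hy
      rw [hδ, map_mul, map_mul] at hy
      exact left_ne_zero_of_mul (left_ne_zero_of_mul hy)
    have hδc : ∀ y, MvPolynomial.eval y δ ≠ 0 → ∀ j, MvPolynomial.eval y (c j) ≠ 0 := by
      intro y hy j
      rw [hδ, map_mul, map_prod] at hy
      exact Finset.prod_ne_zero_iff.1 (right_ne_zero_of_mul hy) j (Finset.mem_univ _)
    have hpre := hypersurface_preconnected hFm hFp δ (by
      intro y hy t ht
      obtain ⟨χ, hχ, rfl⟩ := lying_over f y t ht
      have := key _ g1 h1 χ y hχ (hδ1 y hy)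
      rwa [chi_aeval hχ, fib, ← Polynomial.derivative_map] at this)
    have hco : ∀ χ : R →ₐ[ℂ] ℂ, ∀ y, LiesOver χ y → MvPolynomial.eval y δ ≠ 0 → ∀ j,
        ptOf φ χ j = (fib (N j) y).eval (χ f) / MvPolynomial.eval y (c j) := by
      intro χ y hχ hy j
      rw [eq_div_iff (hδc y hy j), ← chi_aeval hχ, ← hN, map_mul, hχ, mul_comm]
      rfl
    let Φ : (Fin d → ℂ) × ℂ → (ι → ℂ) := fun z j =>
      (fib (N j) z.1).eval z.2 / MvPolynomial.eval z.1 (c j)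
    convert hpre.image Φ ?_ using 1
    · ext x
      constructor
      · rintro ⟨χ, y, hχ, hy, rfl⟩
        refine ⟨(y, χ f), ⟨hy, chi_minpoly hχ f⟩, ?_⟩
        ext j
        exact (hco χ y hχ hy j).symm
      · rintro ⟨⟨y, t⟩, ⟨hy, ht⟩, rfl⟩
        obtain ⟨χ, hχ, rfl⟩ := lying_over f y t ht
        refine ⟨χ, y, hχ, hy, ?_⟩
        ext j
        exact hco χ y hχ hy j
    · refine continuousOn_pi.2 fun j => ?_
      refine ContinuousOn.div (fib_contDiff _).continuous.continuousOn ?_ ?_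
      · exact ((MvPolynomial.continuous_eval _).comp continuous_fst).continuousOn
      · intro z hz
        exact hδc _ hz.1 j

/-- Nonzero polynomials are nonzero arbitrarily close to any point. -/
theorem frequently_eval_ne {d : Type*} [Fintype d] (δ : MvPolynomial d ℂ) (hδ : δ ≠ 0) (y₀ : d → ℂ) :
    ∃ᶠ y in 𝓝 y₀, MvPolynomial.eval y δ ≠ 0 := by
  intro h
  apply hδ
  apply MvPolynomial.funext
  intro y
  have h1 : AnalyticOnNhd ℂ (fun y : d → ℂ => MvPolynomial.eval y δ) Set.univ :=
    AnalyticOnNhd.eval_mvPolynomial δ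
  have := h1.eqOn_zero_of_preconnected_of_eventuallyEq_zero isPreconnected_univ (Set.mem_univ y₀)
    (by filter_upwards [h] with y hy; simpa using hy)
  simpa using this (Set.mem_univ y)

theorem small_root (P : Polynomial ℂ) (hP : P.Monic) (ε : ℝ) (hε : 0 ≤ ε)
    (h : ‖P.eval 0‖ < ε ^ P.natDegree) : ∃ t, P.eval t = 0 ∧ ‖t‖ < ε := by
  by_contra! hcon
  have hs := IsAlgClosed.splits P
  have h1 : P.eval 0 = (P.roots.map fun a => (0 - a)).prod := by
    conv_lhs => rw [hs.eq_prod_roots_of_monic hP]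
    rw [Polynomial.eval_multiset_prod, Multiset.map_map]
    simp
  have h2 : P.natDegree = P.roots.card := hs.natDegree_eq_card_roots
  have h3 : ∀ s : Multiset ℂ, (∀ a ∈ s, ε ≤ ‖a‖) → ε ^ s.card ≤ ‖(s.map fun a => (0 - a)).prod‖ := by
    intro s
    induction s using Multiset.induction_on with
    | empty => simp
    | cons a s ih =>
      intro hs
      rw [Multiset.map_cons, Multiset.prod_cons, norm_mul, Multiset.card_cons, pow_succ', zero_sub,
        norm_neg]
      exact mul_le_mul (hs a (by simp)) (ih fun b hb => hs b (by simp [hb])) (by positivity)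
        (norm_nonneg _)
  have h4 := h3 P.roots fun a ha => hcon a ((Polynomial.mem_roots hP.ne_zero).1 ha)
  rw [← h1, ← h2] at h4
  linarith

theorem generic_dense {ι : Type*} [Fintype ι] [Module.Finite (MvPolynomial (Fin d) ℂ) R]
    [FaithfulSMul (MvPolynomial (Fin d) ℂ) R] (φ : MvPolynomial ι ℂ →ₐ[ℂ] R)
    (hφ : Function.Surjective φ) (δ : MvPolynomial (Fin d) ℂ) (hδ : δ ≠ 0)
    (χ₀ : R →ₐ[ℂ] ℂ) :
    ptOf φ χ₀ ∈ closure {x : ι → ℂ | ∃ χ : R →ₐ[ℂ] ℂ, ∃ y, LiesOver χ y ∧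
        MvPolynomial.eval y δ ≠ 0 ∧ ptOf φ χ = x} := by
  classical
  set y₀ : Fin d → ℂ := fun j => χ₀ (algebraMap (MvPolynomial (Fin d) ℂ) R (MvPolynomial.X j)) with hy₀
  have hχ₀ : LiesOver χ₀ y₀ := by
    intro a
    have : χ₀.comp (IsScalarTower.toAlgHom ℂ (MvPolynomial (Fin d) ℂ) R) =
        MvPolynomial.aeval y₀ := by
      apply MvPolynomial.algHom_ext
      intro j
      simp [hy₀]
    have h := DFunLike.congr_fun this a
    rw [MvPolynomial.aeval_eq_eval] at h
    exact h
  -- the fibre is finite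
  let mp : ι → Polynomial (MvPolynomial (Fin d) ℂ) :=
    fun j => minpoly (MvPolynomial (Fin d) ℂ) (φ (MvPolynomial.X j))
  have hmp : ∀ j, (mp j).Monic := fun j => minpoly.monic (Algebra.IsIntegral.isIntegral _)
  have hroot : ∀ χ : R →ₐ[ℂ] ℂ, ∀ y, LiesOver χ y → ∀ j, (fib (mp j) y).eval (ptOf φ χ j) = 0 :=
    fun χ y hχ j => chi_minpoly hχ _
  have hfin : {x : ι → ℂ | ∃ χ : R →ₐ[ℂ] ℂ, LiesOver χ y₀ ∧ ptOf φ χ = x}.Finite := by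
    refine (Set.Finite.pi (t := fun j => {t | (fib (mp j) y₀).eval t = 0}) fun j => ?_).subset ?_
    · exact Polynomial.finite_setOfPred_isRoot (fib_monic (hmp j) y₀).ne_zero
    · rintro x ⟨χ, hχ, rfl⟩ j -
      exact hroot χ y₀ hχ j
  set x₀ := ptOf φ χ₀ with hx₀
  let Fs := hfin.toFinset.erase x₀
  have hex : ∀ x : ι → ℂ, ∃ j : Option ι, x ≠ x₀ → ∃ k, j = some k ∧ x k ≠ x₀ k := by
    intro x
    by_cases h : x = x₀
    · exact ⟨none, fun h' => absurd h h'⟩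
    · obtain ⟨k, hk⟩ := Function.ne_iff.1 h
      exact ⟨some k, fun _ => ⟨k, rfl, hk⟩⟩
  choose jj hjj using hex
  let fac : (ι → ℂ) → MvPolynomial ι ℂ := fun x =>
    (jj x).elim 1 fun k => MvPolynomial.X k - MvPolynomial.C (x k)
  let p : MvPolynomial ι ℂ := ∏ x ∈ Fs, fac x
  have hp0 : MvPolynomial.eval x₀ p ≠ 0 := by
    rw [map_prod]
    refine Finset.prod_ne_zero_iff.2 fun x hx => ?_
    obtain ⟨k, hk, hne⟩ := hjj x (Finset.ne_of_mem_erase hx)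
    simp only [fac, hk, Option.elim]
    simpa [sub_eq_zero] using hne.symm
  have hp1 : ∀ x ∈ Fs, MvPolynomial.eval x p = 0 := by
    intro x hx
    rw [map_prod]
    refine Finset.prod_eq_zero hx ?_
    obtain ⟨k, hk, hne⟩ := hjj x (Finset.ne_of_mem_erase hx)
    simp [fac, hk]
  let h0 : MvPolynomial ι ℂ := p - MvPolynomial.C (MvPolynomial.eval x₀ p)
  have hh0 : MvPolynomial.eval x₀ h0 = 0 := by simp [h0]
  have hh1 : ∀ χ : R →ₐ[ℂ] ℂ, LiesOver χ y₀ → MvPolynomial.eval (ptOf φ χ) h0 = 0 →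
      ptOf φ χ = x₀ := by
    intro χ hχ h
    by_contra hne
    have : MvPolynomial.eval (ptOf φ χ) p = 0 := hp1 _ (by
      simp only [Fs, Finset.mem_erase, Set.Finite.mem_toFinset]
      exact ⟨hne, χ, hχ, rfl⟩)
    simp [h0, this] at h
    exact hp0 h
  set P := minpoly (MvPolynomial (Fin d) ℂ) (φ h0) with hP
  have hPm : P.Monic := minpoly.monic (Algebra.IsIntegral.isIntegral _)
  have hP0 : (fib P y₀).eval 0 = 0 := by
    have := chi_minpoly hχ₀ (φ h0)
    rwa [chi_phi, ← hx₀, hh0] at this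
  have hPc : Continuous fun y => (fib P y).eval 0 :=
    (fib_contDiff P).continuous.comp (Continuous.prodMk continuous_id continuous_const)
  have hseq : ∀ n : ℕ, ∃ χ : R →ₐ[ℂ] ℂ, ∃ y, LiesOver χ y ∧ MvPolynomial.eval y δ ≠ 0 ∧
      dist y y₀ < 1 / ((n : ℝ) + 1) ∧ ‖χ (φ h0)‖ < 1 / ((n : ℝ) + 1) := by
    intro n
    have hε : (0 : ℝ) < 1 / ((n : ℝ) + 1) := Nat.one_div_pos_of_nat
    have e1 : ∀ᶠ y in 𝓝 y₀, dist y y₀ < 1 / ((n : ℝ) + 1) := Metric.ball_mem_nhds _ hε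
    have e2 : ∀ᶠ y in 𝓝 y₀, ‖(fib P y).eval 0‖ < (1 / ((n : ℝ) + 1)) ^ P.natDegree := by
      refine hPc.norm.continuousAt.eventually_lt continuousAt_const ?_
      rw [hP0, norm_zero]; positivity
    obtain ⟨y, hy, h1, h2⟩ := ((frequently_eval_ne δ hδ y₀).and_eventually (e1.and e2)).exists
    obtain ⟨t, ht, hlt⟩ := small_root (fib P y) (fib_monic hPm y) _ hε.le
      (by rw [hPm.natDegree_map]; exact h2)
    obtain ⟨χ, hχ, rfl⟩ := lying_over (φ h0) y t ht
    exact ⟨χ, y, hχ, hy, h1, hlt⟩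
  choose χs ys hlies hne hdist hsmall using hseq
  have hlim0 : Tendsto (fun n : ℕ => 1 / ((n : ℝ) + 1)) atTop (𝓝 0) :=
    tendsto_one_div_add_atTop_nhds_zero_nat
  have hys : Tendsto ys atTop (𝓝 y₀) :=
    tendsto_iff_dist_tendsto_zero.2 (squeeze_zero (fun _ => dist_nonneg) (fun n => (hdist n).le) hlim0)
  have hhs : Tendsto (fun n => χs n (φ h0)) atTop (𝓝 0) :=
    squeeze_zero_norm (fun n => (hsmall n).le) hlim0
  -- boundedness
  have hbd : ∀ᶠ n in atTop, ptOf φ (χs n) ∈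
      Metric.closedBall (0 : ι → ℂ) (∑ j, (rootBd (mp j) y₀ + 1)) := by
    have : ∀ᶠ n in atTop, ∀ j, rootBd (mp j) (ys n) < rootBd (mp j) y₀ + 1 := by
      rw [eventually_all]
      intro j
      exact (((rootBd_cont (mp j)).tendsto y₀).comp hys).eventually_lt_const (by linarith)
    filter_upwards [this] with n hn
    rw [mem_closedBall_zero_iff]
    have hnn : ∀ j ∈ Finset.univ, 0 ≤ rootBd (mp j) y₀ + 1 := fun j _ => by
      linarith [rootBd_nonneg (mp j) y₀]
    refine (pi_norm_le_iff_of_nonneg (Finset.sum_nonneg hnn)).2 fun j => ?_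
    refine (fib_root_bound (hmp j) (ys n) _ (hroot _ _ (hlies n) j)).trans ((hn j).le.trans ?_)
    exact Finset.single_le_sum (f := fun j => rootBd (mp j) y₀ + 1) hnn (Finset.mem_univ j)
  obtain ⟨x, -, ψ, hψ, hx⟩ := tendsto_subseq_of_frequently_bounded Metric.isBounded_closedBall
    hbd.frequently
  have hev : ∀ q : MvPolynomial ι ℂ, Tendsto (fun n => χs (ψ n) (φ q)) atTop
      (𝓝 (MvPolynomial.eval x q)) := by
    intro q
    simp only [chi_phi]
    exact ((MvPolynomial.continuous_eval q).tendsto x).comp hx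
  have hker : ∀ q : MvPolynomial ι ℂ, φ q = 0 → MvPolynomial.eval x q = 0 := by
    intro q hq
    have := hev q
    simp only [hq, map_zero] at this
    exact (tendsto_nhds_unique this tendsto_const_nhds)
  let χ' : R →ₐ[ℂ] ℂ := (Ideal.Quotient.liftₐ (RingHom.ker φ) (MvPolynomial.aeval x) (by
      intro a ha
      rw [MvPolynomial.aeval_eq_eval]
      exact hker a ha)).comp (Ideal.quotientKerAlgEquivOfSurjective hφ).symm.toAlgHom
  have hχ' : ∀ q, χ' (φ q) = MvPolynomial.eval x q := by
    intro q
    have : (Ideal.quotientKerAlgEquivOfSurjective hφ).symm (φ q) = Ideal.Quotient.mk _ q := by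
      rw [AlgEquiv.symm_apply_eq]; rfl
    simp only [χ', AlgHom.comp_apply]
    erw [this]
    exact (Ideal.Quotient.liftₐ_apply _ _ _ _).trans
      (congrFun (MvPolynomial.aeval_eq_eval x) q)
  have hpt : ptOf φ χ' = x := by
    ext j
    simp [ptOf, hχ']
  have hl : LiesOver χ' y₀ := by
    intro a
    obtain ⟨q, hq⟩ := hφ (algebraMap _ R a)
    rw [← hq, hχ']
    have h1 := hev q
    simp only [hq] at h1
    have h2 : Tendsto (fun n => χs (ψ n) (algebraMap _ R a)) atTop (𝓝 (MvPolynomial.eval y₀ a)) := by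
      have : (fun n => χs (ψ n) (algebraMap _ R a)) = fun n => MvPolynomial.eval (ys (ψ n)) a :=
        funext fun n => hlies _ a
      rw [this]
      exact ((MvPolynomial.continuous_eval a).tendsto y₀).comp (hys.comp hψ.tendsto_atTop)
    exact tendsto_nhds_unique h1 h2
  have hx0 : x = x₀ := by
    rw [← hpt]
    refine hh1 χ' hl ?_
    rw [hpt]
    exact tendsto_nhds_unique (hev h0) (hhs.comp hψ.tendsto_atTop)
  rw [← hx0]
  refine mem_closure_of_tendsto hx (Eventually.of_forall fun n => ?_)
  exact ⟨χs (ψ n), ys (ψ n), hlies _, hne _, rfl⟩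

end geo

theorem irreducible_dense_connected_aux {ι : Type*} [Fintype ι] {R : Type*} [CommRing R]
    [IsDomain R] [Algebra ℂ R] (φ : MvPolynomial ι ℂ →ₐ[ℂ] R)
    (hφ : Function.Surjective φ) (q : MvPolynomial ι ℂ) (hq : φ q ≠ 0) :
    ∃ W : Set (ι → ℂ), (∀ x ∈ W, (∀ p, φ p = 0 → MvPolynomial.eval x p = 0) ∧
        MvPolynomial.eval x q ≠ 0) ∧
      IsPreconnected W ∧ ∀ x, (∀ p, φ p = 0 → MvPolynomial.eval x p = 0) → x ∈ closure W := by
  classical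
  have : Algebra.FiniteType ℂ R := Algebra.FiniteType.of_surjective φ hφ
  obtain ⟨s, g, hg, hgf⟩ := exists_finite_inj_algHom_of_fg ℂ R
  let _ : Algebra (MvPolynomial (Fin s) ℂ) R := g.toRingHom.toAlgebra
  have : IsScalarTower ℂ (MvPolynomial (Fin s) ℂ) R :=
    IsScalarTower.of_algebraMap_eq fun a => (g.commutes a).symm
  have : Module.Finite (MvPolynomial (Fin s) ℂ) R := hgf
  have : FaithfulSMul (MvPolynomial (Fin s) ℂ) R :=
    (faithfulSMul_iff_algebraMap_injective _ _).2 hg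
  obtain ⟨δ, hδ, hδq, hconn⟩ := generic_connected (d := s) φ (φ q) hq
  refine ⟨_, ?_, hconn, ?_⟩
  · rintro x ⟨χ, y, hχ, hy, rfl⟩
    refine ⟨fun p hp => ?_, ?_⟩
    · rw [← chi_phi, hp, map_zero]
    · rw [← chi_phi]
      exact hδq χ y hχ hy
  · intro x hx
    let χ : R →ₐ[ℂ] ℂ := (Ideal.Quotient.liftₐ (RingHom.ker φ) (MvPolynomial.aeval x) (by
      intro a ha
      rw [MvPolynomial.aeval_eq_eval]
      exact hx a ha)).comp (Ideal.quotientKerAlgEquivOfSurjective hφ).symm.toAlgHom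
    have := generic_dense (d := s) φ hφ δ hδ χ
    have h2 : ptOf φ χ = x := by
      ext j
      have h3 : (Ideal.quotientKerAlgEquivOfSurjective hφ).symm (φ (MvPolynomial.X j)) =
          Ideal.Quotient.mk _ (MvPolynomial.X j) := by
        rw [AlgEquiv.symm_apply_eq]; rfl
      have h4 : χ (φ (MvPolynomial.X j)) = MvPolynomial.aeval x (MvPolynomial.X j : MvPolynomial ι ℂ) := by
        simp only [χ, AlgHom.comp_apply]
        erw [h3]
        rfl
      rw [ptOf, h4, MvPolynomial.aeval_X]
    rwa [h2] at this

theorem irreducible_dense_connected {ι : Type*} [Fintype ι] (I : Ideal (MvPolynomial ι ℂ))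
    (hI : I.IsPrime) (q : MvPolynomial ι ℂ) (hq : q ∉ I) :
    ∃ W : Set (ι → ℂ), (∀ x ∈ W, (∀ p ∈ I, MvPolynomial.eval x p = 0) ∧ MvPolynomial.eval x q ≠ 0) ∧
      IsPreconnected W ∧ ∀ x, (∀ p ∈ I, MvPolynomial.eval x p = 0) → x ∈ closure W := by
  have h := irreducible_dense_connected_aux (Ideal.Quotient.mkₐ ℂ I)
    (Ideal.Quotient.mkₐ_surjective ℂ I) q (fun h => hq (Ideal.Quotient.eq_zero_iff_mem.1 h))
  have e : ∀ p, Ideal.Quotient.mkₐ ℂ I p = 0 ↔ p ∈ I := fun p => Ideal.Quotient.eq_zero_iff_mem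
  simpa only [e] using h

section grass
variable {n k : ℕ}

/-- Change of presentation of a flat. -/
def actP (g : Matrix (Fin k) (Fin k) ℂ) (p : PIdx n k → ℂ) : PIdx n k → ℂ :=
  Sum.elim (fun rc => ∑ s, g rc.1 s * p (Sum.inl (s, rc.2))) (fun r => ∑ s, g r s * p (Sum.inr s))

theorem matP_act (g : Matrix (Fin k) (Fin k) ℂ) (p : PIdx n k → ℂ) :
    matP (actP g p) = g * matP p := by
  ext r c
  simp [matP, actP, Matrix.mul_apply]

theorem vecP_act (g : Matrix (Fin k) (Fin k) ℂ) (p : PIdx n k → ℂ) :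
    vecP (actP g p) = g.mulVec (vecP p) := by
  ext r
  simp [vecP, actP, Matrix.mulVec, dotProduct]

theorem ext_P {p p' : PIdx n k → ℂ} (h : matP p = matP p') (h' : vecP p = vecP p') : p = p' := by
  ext (⟨r, c⟩ | r)
  · exact congrFun (congrFun h r) c
  · exact congrFun h' r

theorem act_mul (g h : Matrix (Fin k) (Fin k) ℂ) (p : PIdx n k → ℂ) :
    actP g (actP h p) = actP (g * h) p := by
  apply ext_P
  · simp [matP_act, Matrix.mul_assoc]
  · simp [vecP_act]

theorem act_one (p : PIdx n k → ℂ) : actP 1 p = p := by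
  apply ext_P
  · simp [matP_act]
  · simp [vecP_act]

theorem mem_paramSet_iff (p : PIdx n k → ℂ) :
    p ∈ paramSet n k ↔ ∃ B : Matrix (Fin n) (Fin k) ℂ, matP p * B = 1 := by
  have h1 : p ∈ paramSet n k ↔ LinearMap.range (matP p).mulVecLin = ⊤ := by
    constructor
    · intro h
      exact Submodule.eq_top_of_finrank_eq (by rw [Module.finrank_fin_fun]; exact h)
    · intro h
      change Module.finrank ℂ (LinearMap.range (matP p).mulVecLin) = k
      rw [h, finrank_top, Module.finrank_fin_fun]
  rw [h1, LinearMap.range_eq_top]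
  exact Matrix.mulVec_surjective_iff_exists_right_inverse

theorem act_mem {g : Matrix (Fin k) (Fin k) ℂ} (hg : g.det ≠ 0) {p : PIdx n k → ℂ}
    (hp : p ∈ paramSet n k) : actP g p ∈ paramSet n k := by
  rw [mem_paramSet_iff] at *
  obtain ⟨B, hB⟩ := hp
  refine ⟨B * g⁻¹, ?_⟩
  rw [matP_act, Matrix.mul_assoc, ← Matrix.mul_assoc (matP p), hB, Matrix.one_mul,
    Matrix.mul_nonsing_inv _ (isUnit_iff_ne_zero.2 hg)]

theorem flat_act {g : Matrix (Fin k) (Fin k) ℂ} (hg : g.det ≠ 0) (p : PIdx n k → ℂ) :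
    flatP (actP g p) = flatP p := by
  ext x
  simp only [flatP, Set.mem_ofPred_eq, matP_act, vecP_act, ← Matrix.mulVec_mulVec]
  constructor
  · intro h
    have := congrArg (g⁻¹.mulVec) h
    simpa [Matrix.mulVec_mulVec, Matrix.nonsing_inv_mul _ (isUnit_iff_ne_zero.2 hg),
      ← Matrix.mul_assoc] using this
  · intro h; rw [h]

theorem flat_eq {p p' : PIdx n k → ℂ} (hp : p ∈ paramSet n k) (hp' : p' ∈ paramSet n k)
    (h : flatP p = flatP p') : ∃ g : Matrix (Fin k) (Fin k) ℂ, g.det ≠ 0 ∧ p' = actP g p := by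
  rw [mem_paramSet_iff] at hp hp'
  obtain ⟨B, hB⟩ := hp
  obtain ⟨B', hB'⟩ := hp'
  have hx0 : (matP p).mulVec (B.mulVec (vecP p)) = vecP p := by
    rw [Matrix.mulVec_mulVec, hB, Matrix.one_mulVec]
  have hx0' : (matP p').mulVec (B.mulVec (vecP p)) = vecP p' := by
    have : B.mulVec (vecP p) ∈ flatP p' := by rw [← h]; exact hx0
    exact this
  have hker : ∀ v, (matP p).mulVec v = 0 → (matP p').mulVec v = 0 := by
    intro v hv
    have : B.mulVec (vecP p) + v ∈ flatP p' := by
      rw [← h]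
      change (matP p).mulVec _ = _
      rw [Matrix.mulVec_add, hx0, hv, add_zero]
    have h2 : (matP p').mulVec (B.mulVec (vecP p) + v) = vecP p' := this
    rw [Matrix.mulVec_add, hx0'] at h2
    simpa using h2
  have hM : matP p' = (matP p' * B) * matP p := by
    apply Matrix.mulVec_injective
    ext1 x
    have := hker (x - B.mulVec ((matP p).mulVec x)) (by
      rw [Matrix.mulVec_sub, Matrix.mulVec_mulVec, hB, Matrix.one_mulVec, sub_self])
    rw [Matrix.mulVec_sub, sub_eq_zero] at this
    rw [this]
    simp [Matrix.mulVec_mulVec, Matrix.mul_assoc]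
  refine ⟨matP p' * B, ?_, ext_P ?_ ?_⟩
  · have h1 : (matP p' * B) * (matP p * B') = 1 := by
      rw [← Matrix.mul_assoc, ← hM, hB']
    intro h0
    have := congrArg Matrix.det h1
    rw [Matrix.det_mul, h0, zero_mul, Matrix.det_one] at this
    exact zero_ne_one this
  · rw [matP_act]; exact hM
  · rw [vecP_act, ← hx0', Matrix.mulVec_mulVec]

/-- The pullback of a polynomial under the action of `g`. -/
noncomputable def pullAct (g : Matrix (Fin k) (Fin k) ℂ) (q : MvPolynomial (PIdx n k) ℂ) :
    MvPolynomial (PIdx n k) ℂ :=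
  MvPolynomial.bind₁ (Sum.elim
    (fun rc => ∑ s, MvPolynomial.C (g rc.1 s) * MvPolynomial.X (Sum.inl (s, rc.2)))
    (fun r => ∑ s, MvPolynomial.C (g r s) * MvPolynomial.X (Sum.inr s))) q

theorem eval_pullAct (g : Matrix (Fin k) (Fin k) ℂ) (q : MvPolynomial (PIdx n k) ℂ)
    (p : PIdx n k → ℂ) : MvPolynomial.eval p (pullAct g q) = MvPolynomial.eval (actP g p) q := by
  rw [pullAct, ← MvPolynomial.coe_aeval_eq_eval, ← MvPolynomial.coe_aeval_eq_eval]
  simp only [RingHom.coe_coe]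
  rw [MvPolynomial.aeval_bind₁]
  congr 2
  ext (⟨r, c⟩ | r) <;> simp [actP]

/-- The orbit polynomial. -/
noncomputable def orbPoly (p : PIdx n k → ℂ) (q : MvPolynomial (PIdx n k) ℂ) :
    MvPolynomial (Fin k × Fin k) ℂ :=
  MvPolynomial.bind₁ (Sum.elim
    (fun rc => ∑ s, MvPolynomial.X (rc.1, s) * MvPolynomial.C (p (Sum.inl (s, rc.2))))
    (fun r => ∑ s, MvPolynomial.X (r, s) * MvPolynomial.C (p (Sum.inr s)))) q

theorem eval_orbPoly (g : Fin k × Fin k → ℂ) (q : MvPolynomial (PIdx n k) ℂ)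
    (p : PIdx n k → ℂ) : MvPolynomial.eval g (orbPoly p q) =
      MvPolynomial.eval (actP (Matrix.of fun r s => g (r, s)) p) q := by
  rw [orbPoly, ← MvPolynomial.coe_aeval_eq_eval, ← MvPolynomial.coe_aeval_eq_eval]
  simp only [RingHom.coe_coe]
  rw [MvPolynomial.aeval_bind₁]
  congr 2
  ext (⟨r, c⟩ | r) <;> simp [actP]

theorem eval_detX (g : Fin k × Fin k → ℂ) :
    MvPolynomial.eval g (Matrix.mvPolynomialX (Fin k) (Fin k) ℂ).det =
      (Matrix.of fun r s => g (r, s)).det := by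
  rw [RingHom.map_det]
  congr 1
  ext r s
  simp

/-- The vanishing ideal of a set. -/
def vanI {ι : Type*} (S : Set (ι → ℂ)) : Ideal (MvPolynomial ι ℂ) where
  carrier := {q | ∀ p ∈ S, MvPolynomial.eval p q = 0}
  zero_mem' := fun p _ => map_zero _
  add_mem' := fun {a b} ha hb p hp => by rw [map_add, ha p hp, hb p hp, add_zero]
  smul_mem' := fun c a ha p hp => by rw [smul_eq_mul, map_mul, ha p hp, mul_zero]

theorem mem_vanI {ι : Type*} {S : Set (ι → ℂ)} {q : MvPolynomial ι ℂ} :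
    q ∈ vanI S ↔ ∀ p ∈ S, MvPolynomial.eval p q = 0 := Iff.rfl

theorem rel_closed {i : ℕ} (q : MvPolynomial (PIdx n (n - i)) ℂ) :
    pre n i (flatP '' ({p | ∀ g : Matrix (Fin (n - i)) (Fin (n - i)) ℂ, g.det ≠ 0 →
      MvPolynomial.eval (actP g p) q = 0} ∩ paramSet n (n - i))) =
    {p | ∀ g : Matrix (Fin (n - i)) (Fin (n - i)) ℂ, g.det ≠ 0 →
      MvPolynomial.eval (actP g p) q = 0} ∩ paramSet n (n - i) := by
  ext p
  constructor
  · rintro ⟨hp, p', ⟨hp', hpp'⟩, heq⟩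
    refine ⟨fun g hg => ?_, hp⟩
    obtain ⟨h, hh, rfl⟩ := flat_eq hpp' hp heq
    rw [act_mul]
    exact hp' _ (by rw [Matrix.det_mul]; exact mul_ne_zero hg hh)
  · rintro ⟨h1, h2⟩
    exact ⟨h2, p, ⟨h1, h2⟩, rfl⟩

theorem rel_closed' {i : ℕ} (q : MvPolynomial (PIdx n (n - i)) ℂ) :
    IsRelZariskiClosedFam n i
     (flatP '' ({p | ∀ g : Matrix (Fin (n - i)) (Fin (n - i)) ℂ, g.det ≠ 0 →
      MvPolynomial.eval (actP g p) q = 0} ∩ paramSet n (n - i))) := by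
  refine ⟨?_, _, ?_, rel_closed q⟩
  · rintro A ⟨p, ⟨-, hp⟩, rfl⟩
    exact ⟨p, hp, rfl⟩
  · refine ⟨{Q | ∃ g : Matrix (Fin (n - i)) (Fin (n - i)) ℂ, g.det ≠ 0 ∧ Q = pullAct g q}, ?_⟩
    ext p
    constructor
    · rintro h Q ⟨g, hg, rfl⟩
      rw [eval_pullAct]; exact h g hg
    · intro h g hg
      rw [← eval_pullAct]; exact h _ ⟨g, hg, rfl⟩

theorem pre_nonempty {i : ℕ} {T : Set (Set (Fin n → ℂ))} (hT : T ⊆ grAffC n i)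
    (h : T.Nonempty) : (pre n i T).Nonempty := by
  obtain ⟨A, hA⟩ := h
  obtain ⟨p, hp, rfl⟩ := hT hA
  exact ⟨p, hp, hA⟩

theorem vanI_prime {i : ℕ} {T : Set (Set (Fin n → ℂ))} (hT : T ⊆ grAffC n i)
    (hirr : IsIrreducibleFam n i T) : (vanI (pre n i T)).IsPrime := by
  obtain ⟨hne, hirr⟩ := hirr
  obtain ⟨p₀, hp₀⟩ := pre_nonempty hT hne
  refine ⟨fun h => ?_, fun {q₁ q₂} hq => ?_⟩
  · have : (1 : MvPolynomial (PIdx n (n - i)) ℂ) ∈ vanI (pre n i T) := h ▸ Submodule.mem_top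
    have := this p₀ hp₀
    simp at this
  have fin : ∀ q : MvPolynomial (PIdx n (n - i)) ℂ, T ⊆ (flatP '' ({p | ∀ g : Matrix (Fin (n - i)) (Fin (n - i)) ℂ, g.det ≠ 0 →
      MvPolynomial.eval (actP g p) q = 0} ∩ paramSet n (n - i))) → q ∈ vanI (pre n i T) := by
    intro q hq p hp
    have h1 : p ∈ pre n i (flatP '' ({p | ∀ g : Matrix (Fin (n - i)) (Fin (n - i)) ℂ, g.det ≠ 0 →
      MvPolynomial.eval (actP g p) q = 0} ∩ paramSet n (n - i))) := ⟨hp.1, hq hp.2⟩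
    rw [rel_closed] at h1
    have := h1.1 1 (by simp)
    rwa [act_one] at this
  refine (hirr _ _ (rel_closed' q₁) (rel_closed' q₂) ?_).imp (fin q₁) (fin q₂)
  intro A hA
  obtain ⟨p, hp, rfl⟩ := hT hA
  by_contra hcon
  rw [Set.mem_union, not_or] at hcon
  have aux : ∀ q : MvPolynomial (PIdx n (n - i)) ℂ, flatP p ∉ (flatP '' ({p | ∀ g : Matrix (Fin (n - i)) (Fin (n - i)) ℂ, g.det ≠ 0 →
      MvPolynomial.eval (actP g p) q = 0} ∩ paramSet n (n - i))) → orbPoly p q ≠ 0 := by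
    intro q hq h0
    apply hq
    refine ⟨p, ⟨fun g _ => ?_, hp⟩, rfl⟩
    have := eval_orbPoly (fun rs => g rs.1 rs.2) q p
    rw [h0, map_zero] at this
    exact this.symm
  have h3 : (Matrix.mvPolynomialX (Fin (n - i)) (Fin (n - i)) ℂ).det ≠ 0 :=
    Matrix.det_mvPolynomialX_ne_zero _ _
  refine mul_ne_zero h3 (mul_ne_zero (aux q₁ hcon.1) (aux q₂ hcon.2)) (MvPolynomial.funext fun g => ?_)
  rw [map_mul, map_mul, map_zero, eval_detX, eval_orbPoly, eval_orbPoly]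
  by_cases hg : (Matrix.of fun r s => g (r, s)).det = 0
  · rw [hg, zero_mul]
  · rw [← map_mul, hq _ ⟨act_mem hg hp, by rw [flat_act hg]; exact hA⟩, mul_zero]

theorem exists_q {ι : Type*} {S : Set (ι → ℂ)} (hS : IsZariskiLocallyClosed S) (hne : S.Nonempty) :
    ∃ q ∉ vanI S, ∀ x, (∀ p ∈ vanI S, MvPolynomial.eval x p = 0) → MvPolynomial.eval x q ≠ 0 →
      x ∈ S := by
  obtain ⟨C, D, ⟨P, hP⟩, ⟨P', hP'⟩, rfl⟩ := hS
  obtain ⟨p₀, h1, h2⟩ := hne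
  rw [hP'] at h2
  simp only [Set.mem_ofPred_eq, not_forall] at h2
  obtain ⟨q, hq, hq0⟩ := h2
  refine ⟨q, fun h => hq0 (h p₀ ⟨h1, ?_⟩), fun x hx hxq => ⟨?_, ?_⟩⟩
  · rw [hP']; exact fun h => hq0 (h q hq)
  · rw [hP]
    intro p hp
    refine hx p fun y hy => ?_
    have := hy.1
    rw [hP] at this
    exact this p hp
  · rw [hP']
    exact fun h => hxq (h q hq)

theorem loc_connected {ι : Type*} [Fintype ι] {S : Set (ι → ℂ)} (hS : IsZariskiLocallyClosed S)
    (hne : S.Nonempty) (hpr : (vanI S).IsPrime) : IsConnected S := by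
  obtain ⟨q, hq, hqS⟩ := exists_q hS hne
  obtain ⟨W, hW, hc, hd⟩ := irreducible_dense_connected _ hpr q hq
  exact ⟨hne, hc.subset_closure (fun x hx => hqS x (hW x hx).1 (hW x hx).2)
    fun x hx => hd x fun p hp => hp x hx⟩

theorem loc_identity {ι : Type*} [Fintype ι] {S : Set (ι → ℂ)} (hS : IsZariskiLocallyClosed S)
    (hpr : (vanI S).IsPrime) {V : Set (ι → ℂ)} (hV : IsOpen V)
    (hne : (S ∩ V).Nonempty) (Q : MvPolynomial ι ℂ)
    (hQ : ∀ p ∈ S ∩ V, MvPolynomial.eval p Q = 0) : ∀ p ∈ S, MvPolynomial.eval p Q = 0 := by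
  by_contra hcon
  obtain ⟨q, hq, hqS⟩ := exists_q hS (hne.mono Set.inter_subset_left)
  obtain ⟨W, hW, hc, hd⟩ := irreducible_dense_connected _ hpr (q * Q) (fun h =>
    (hpr.mem_or_mem h).elim hq hcon)
  obtain ⟨x, hx, hxV⟩ := hne
  obtain ⟨w, hwV, hw⟩ := mem_closure_iff.1 (hd x fun p hp => hp x hx) V hV hxV
  obtain ⟨h1, h2⟩ := hW w hw
  rw [map_mul] at h2
  exact right_ne_zero_of_mul h2 (hQ w ⟨hqS w h1 (left_ne_zero_of_mul h2), hwV⟩)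

theorem dir_eq {S : Set (PIdx n k → ℂ)} (hS : IsZariskiLocallyClosed S) (hSp : S ⊆ paramSet n k)
    (hpr : (vanI S).IsPrime) {V : Set (PIdx n k → ℂ)} (hV : IsOpen V)
    (hne : (S ∩ V).Nonempty) : dirSpanC (S ∩ V) = dirSpanC S := by
  apply le_antisymm
  · exact biSup_mono fun p hp => hp.1
  refine iSup₂_le fun p₀ hp₀ x hx => ?_
  by_contra hcon
  obtain ⟨ℓ, hℓx, hℓ⟩ := Submodule.exists_le_ker_of_notMem hcon
  obtain ⟨B, hB⟩ := (mem_paramSet_iff p₀).1 (hSp hp₀)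
  have hMx : (matP p₀).mulVec x = 0 := hx
  let v : (PIdx n k → ℂ) → (Fin n → ℂ) := fun p =>
    (matP p * B).det • x - (B * (matP p * B).adjugate * matP p).mulVec x
  have hv : ∀ p, v p ∈ dirP p := by
    intro p
    change (matP p).mulVec (v p) = 0
    simp only [v]
    rw [Matrix.mulVec_sub, Matrix.mulVec_smul, Matrix.mulVec_mulVec, ← Matrix.mul_assoc,
      ← Matrix.mul_assoc, Matrix.mul_adjugate]
    simp [Matrix.smul_mulVec]
  have hv0 : v p₀ = x := by
    simp only [v]
    rw [hB, Matrix.det_one, one_smul, ← Matrix.mulVec_mulVec, hMx, Matrix.mulVec_zero, sub_zero]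
  let Mp : Matrix (Fin k) (Fin n) (MvPolynomial (PIdx n k) ℂ) :=
    Matrix.of fun r c => MvPolynomial.X (Sum.inl (r, c))
  let B' : Matrix (Fin n) (Fin k) (MvPolynomial (PIdx n k) ℂ) := B.map MvPolynomial.C
  let x' : Fin n → MvPolynomial (PIdx n k) ℂ := fun j => MvPolynomial.C (x j)
  let v' : Fin n → MvPolynomial (PIdx n k) ℂ :=
    (Mp * B').det • x' - (B' * (Mp * B').adjugate * Mp).mulVec x'
  have hMp : ∀ p, Mp.map (MvPolynomial.eval p) = matP p := by
    intro p; ext r c; simp [Mp, matP]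
  have hB' : ∀ p : PIdx n k → ℂ, B'.map (MvPolynomial.eval p) = B := by
    intro p; ext r c; simp [B']
  have hx' : ∀ p : PIdx n k → ℂ, (MvPolynomial.eval p) ∘ x' = x := by
    intro p; ext j; simp [x']
  have hv' : ∀ p j, MvPolynomial.eval p (v' j) = v p j := by
    intro p j
    simp only [v', v, Pi.sub_apply, Pi.smul_apply, smul_eq_mul, map_sub, map_mul]
    rw [RingHom.map_det, RingHom.map_mulVec, hx']
    simp only [RingHom.mapMatrix_apply, Matrix.map_mul, hMp, hB']
    have := RingHom.map_adjugate (MvPolynomial.eval p) (Mp * B')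
    simp only [RingHom.mapMatrix_apply, Matrix.map_mul, hMp, hB'] at this
    rw [this]
    simp [x']
  let Q : MvPolynomial (PIdx n k) ℂ := ∑ j, MvPolynomial.C (ℓ (Pi.single j 1)) * v' j
  have hQ : ∀ p, MvPolynomial.eval p Q = ℓ (v p) := by
    intro p
    simp only [Q, map_sum, map_mul, MvPolynomial.eval_C, hv']
    conv_rhs => rw [pi_eq_sum_univ' (v p)]
    rw [map_sum]
    refine Finset.sum_congr rfl fun j _ => ?_
    rw [map_smul, smul_eq_mul, mul_comm]
  have := loc_identity hS hpr hV hne Q (fun p hp => by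
    rw [hQ]
    exact hℓ ((le_iSup₂_of_le (f := fun p _ => dirP p) p hp le_rfl : dirP p ≤ dirSpanC (S ∩ V)) (hv p))) p₀ hp₀
  rw [hQ, hv0] at this
  exact hℓx this

end grass

section holo
variable {E F : Type*} [NormedAddCommGroup E] [NormedSpace ℂ E]
  [NormedAddCommGroup F] [NormedSpace ℂ F] [CompleteSpace F]

theorem dslope_estimate {h : ℂ → F} {r : ℝ} (hr : 0 < r)
    (hd : DifferentiableOn ℂ h (Metric.ball 0 r))
    (hb : ∀ z ∈ Metric.ball (0 : ℂ) r, dist (h z) (h 0) ≤ 2) {t : ℂ} (ht : t ∈ Metric.ball (0 : ℂ) r)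
    (ht0 : t ≠ 0) : dist (t⁻¹ • (h t - h 0)) (deriv h 0) ≤ 4 / r / r * ‖t‖ := by
  have h1 : DifferentiableOn ℂ (dslope h 0) (Metric.ball 0 r) :=
    (Complex.differentiableOn_dslope (Metric.ball_mem_nhds _ hr)).2 hd
  have h2 : ∀ z ∈ Metric.ball (0 : ℂ) r, ‖dslope h 0 z‖ ≤ 2 / r := fun z hz =>
    Complex.norm_dslope_le_div_of_mapsTo_ball hd (fun w hw => hb w hw) hz
  have h3 := Complex.dist_le_div_mul_dist_of_mapsTo_ball (R₂ := 4 / r) h1 (fun w hw => by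
    rw [Metric.mem_closedBall]
    refine (dist_le_norm_add_norm _ _).trans ?_
    have := add_le_add (h2 w hw) (h2 0 (Metric.mem_ball_self hr))
    refine this.trans (le_of_eq ?_)
    ring) ht
  rw [dslope_same, dslope_of_ne _ ht0, slope_def_module] at h3
  simpa using h3

theorem dir_deriv_diff {f : E → F} {U : Set E} (hU : IsOpen U) (hf : DifferentiableOn ℂ f U)
    (v : E) : DifferentiableOn ℂ (fun x => fderiv ℂ f x v) U := by
  intro x₀ hx₀
  apply DifferentiableAt.differentiableWithinAt
  have hfa : ∀ x ∈ U, DifferentiableAt ℂ f x := fun x hx => hf.differentiableAt (hU.mem_nhds hx)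
  obtain ⟨ρ', hρ', hball⟩ : ∃ ρ > 0, Metric.ball x₀ ρ ⊆ U ∩ {x | dist (f x) (f x₀) < 1} := by
    refine Metric.mem_nhds_iff.1 (inter_mem (hU.mem_nhds hx₀) ?_)
    exact (hfa x₀ hx₀).continuousAt (Metric.ball_mem_nhds _ one_pos)
  obtain ⟨ρ, hρ, rfl⟩ : ∃ ρ > 0, ρ' = 3 * ρ := ⟨ρ' / 3, by positivity, by ring⟩
  set r := ρ / (‖v‖ + 1) with hr
  have hrp : 0 < r := by positivity
  have hrv : ∀ t : ℂ, ‖t‖ < r → ‖t • v‖ < ρ := by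
    intro t ht
    rw [norm_smul]
    rw [hr, lt_div_iff₀ (by positivity)] at ht
    nlinarith [norm_nonneg t]
  have hmem : ∀ x ∈ Metric.ball x₀ (2 * ρ), ∀ t : ℂ, ‖t‖ < r → x + t • v ∈ Metric.ball x₀ (3 * ρ) := by
    intro x hx t ht
    rw [Metric.mem_ball, dist_eq_norm] at *
    have : x + t • v - x₀ = (x - x₀) + t • v := by abel
    rw [this]
    refine (norm_add_le _ _).trans_lt ?_
    linarith [hrv t ht]
  let t : ℕ → ℂ := fun m => ((r * (1 / ((m : ℝ) + 2)) : ℝ) : ℂ)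
  have htn : ∀ m, ‖t m‖ = r * (1 / ((m : ℝ) + 2)) := by
    intro m
    simp only [t]
    rw [Complex.norm_real, Real.norm_of_nonneg (by positivity)]
  have ht0 : ∀ m, t m ≠ 0 := fun m => by
    rw [← norm_pos_iff, htn]; positivity
  have htr : ∀ m, ‖t m‖ < r := by
    intro m
    rw [htn]
    have : 1 / ((m : ℝ) + 2) < 1 := by
      rw [div_lt_one (by positivity)]; linarith [(Nat.cast_nonneg m : (0 : ℝ) ≤ m)]
    nlinarith
  have htlim : Tendsto (fun m => ‖t m‖) atTop (𝓝 0) := by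
    simp only [htn]
    have h1 : Tendsto (fun m : ℕ => 1 / ((m : ℝ) + 2)) atTop (𝓝 0) := by
      have := tendsto_one_div_add_atTop_nhds_zero_nat (𝕜 := ℝ)
      have h2 := this.comp (tendsto_add_atTop_nat 1)
      refine h2.congr fun m => ?_
      simp only [Function.comp]
      push_cast
      ring
    simpa using h1.const_mul r
  let g : ℕ → E → F := fun m x => (t m)⁻¹ • (f (x + t m • v) - f x)
  have hest : ∀ m, ∀ x ∈ Metric.ball x₀ (2 * ρ), dist (g m x) (fderiv ℂ f x v) ≤ 4 / r / r * ‖t m‖ := by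
    intro m x hx
    have hxU : x ∈ U := (hball (Metric.ball_subset_ball (by linarith) hx)).1
    have hder : HasDerivAt (fun z : ℂ => f (x + z • v)) (fderiv ℂ f x v) 0 := by
      have h1 : HasDerivAt (fun z : ℂ => x + z • v) v 0 := by
        simpa using ((hasDerivAt_id (0 : ℂ)).smul_const v).const_add x
      have h2 : HasFDerivAt f (fderiv ℂ f x) (x + (0 : ℂ) • v) := by
        simpa using (hfa x hxU).hasFDerivAt
      exact h2.comp_hasDerivAt (0 : ℂ) h1
    have := dslope_estimate (h := fun z : ℂ => f (x + z • v)) hrp (by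
      intro z hz
      apply DifferentiableAt.differentiableWithinAt
      have hz' := (hball (hmem x hx z (by simpa using hz))).1
      exact (hfa _ hz').comp z (by fun_prop)) (by
      intro z hz
      have h1 : dist (f (x + z • v)) (f x₀) < 1 := (hball (hmem x hx z (by simpa using hz))).2
      have h2 : dist (f x) (f x₀) < 1 := (hball (Metric.ball_subset_ball (by linarith) hx)).2
      simp only [zero_smul, add_zero]
      have := dist_triangle_right (f (x + z • v)) (f x) (f x₀)
      linarith) (t := t m) (by simpa using htr m) (ht0 m)
    rw [hder.deriv] at this
    simpa [g] using this
  have hgd : ∀ m, ∀ x ∈ Metric.ball x₀ (2 * ρ), DifferentiableAt ℂ (g m) x := by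
    intro m x hx
    have hxU : x ∈ U := (hball (Metric.ball_subset_ball (by linarith) hx)).1
    have hz' := (hball (hmem x hx _ (htr m))).1
    refine DifferentiableAt.const_smul (DifferentiableAt.sub ?_ (hfa x hxU)) _
    exact (hfa _ hz').comp x (by fun_prop)
  have hsub : ∀ x ∈ Metric.ball x₀ ρ, Metric.ball x ρ ⊆ Metric.ball x₀ (2 * ρ) := by
    intro x hx
    apply Metric.ball_subset_ball'
    rw [Metric.mem_ball] at hx
    linarith
  have hcau : ∀ m l, ∀ x ∈ Metric.ball x₀ ρ,
      dist (fderiv ℂ (g m) x) (fderiv ℂ (g l) x) ≤ 2 * (4 / r / r * (‖t m‖ + ‖t l‖)) / ρ := by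
    intro m l x hx
    have hx2 : x ∈ Metric.ball x₀ (2 * ρ) := Metric.ball_subset_ball (by linarith) hx
    rw [dist_eq_norm, ← fderiv_sub (hgd m x hx2) (hgd l x hx2)]
    have hb : ∀ z ∈ Metric.ball x₀ (2 * ρ), ‖(g m - g l) z‖ ≤ 4 / r / r * (‖t m‖ + ‖t l‖) := by
      intro z hz
      rw [Pi.sub_apply, ← dist_eq_norm]
      refine (dist_triangle_right _ _ (fderiv ℂ f z v)).trans ?_
      rw [mul_add]
      exact add_le_add (hest m z hz) (hest l z hz)
    refine Complex.norm_fderiv_le_div_of_mapsTo_ball ?_ ?_ hρ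
    · intro z hz
      exact ((hgd m z (hsub x hx hz)).sub (hgd l z (hsub x hx hz))).differentiableWithinAt
    · intro z hz
      rw [Metric.mem_closedBall]
      refine (dist_le_norm_add_norm _ _).trans ?_
      linarith [hb z (hsub x hx hz), hb x hx2]
  have huc : UniformCauchySeqOn (fun m => fderiv ℂ (g m)) atTop (Metric.ball x₀ ρ) := by
    rw [Metric.uniformCauchySeqOn_iff]
    intro ε hε
    have hl : Tendsto (fun m => 2 * (4 / r / r * (‖t m‖ + ‖t m‖)) / ρ) atTop (𝓝 0) := by
      have := (((htlim.add htlim).const_mul (4 / r / r)).const_mul 2).div_const ρ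
      simpa using this
    have hl2 : Tendsto (fun m => 2 * (4 / r / r * ‖t m‖) / ρ) atTop (𝓝 0) := by
      have := ((htlim.const_mul (4 / r / r)).const_mul 2).div_const ρ
      simpa using this
    obtain ⟨N, hN⟩ := eventually_atTop.1 (hl2.eventually_lt_const (half_pos hε))
    refine ⟨N, fun m hm l hl x hx => (hcau m l x hx).trans_lt ?_⟩
    have h1 := hN m hm
    have h2 := hN l hl
    have : 2 * (4 / r / r * (‖t m‖ + ‖t l‖)) / ρ =
      2 * (4 / r / r * ‖t m‖) / ρ + 2 * (4 / r / r * ‖t l‖) / ρ := by ring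
    linarith
  have hpt : ∀ x ∈ Metric.ball x₀ ρ, ∃ L, Tendsto (fun m => fderiv ℂ (g m) x) atTop (𝓝 L) :=
    fun x hx => cauchySeq_tendsto_of_complete (huc.cauchySeq hx)
  choose! g' hg' using hpt
  have hunif : TendstoUniformlyOn (fun m => fderiv ℂ (g m)) g' atTop (Metric.ball x₀ ρ) :=
    huc.tendstoUniformlyOn_of_tendsto hg'
  refine (hasFDerivAt_of_tendstoUniformlyOn Metric.isOpen_ball hunif
    (fun m x hx => (hgd m x (Metric.ball_subset_ball (by linarith) hx)).hasFDerivAt)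
    (fun x hx => ?_) (Metric.mem_ball_self hρ)).differentiableAt
  refine tendsto_iff_dist_tendsto_zero.2 (squeeze_zero (fun _ => dist_nonneg)
    (fun m => hest m x (Metric.ball_subset_ball (by linarith) hx)) ?_)
  simpa using htlim.const_mul (4 / r / r)

theorem holo_contDiffOn [FiniteDimensional ℂ E] {U : Set E} (hU : IsOpen U) {f : E → F}
    (hf : DifferentiableOn ℂ f U) : ContDiffOn ℂ (⊤ : ℕ∞) f U := by
  rw [contDiffOn_infty]
  intro m
  induction m generalizing f with
  | zero => exact contDiffOn_zero.2 hf.continuousOn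
  | succ m ih =>
    have := (contDiffOn_succ_iff_fderiv_of_isOpen (n := (m : WithTop ℕ∞)) (f := f) hU).2
      ⟨hf, fun h => by simp at h,
        contDiffOn_clm_apply.2 fun v => ih (dir_deriv_diff hU hf v)⟩
    exact_mod_cast this

end holo

theorem real_submanifold {ι : Type*} [Fintype ι] {S : Set (ι → ℂ)} (hS : IsComplexSubmanifold S) :
    IsSmoothSubmanifold S := by
  intro x hx
  obtain ⟨d, U, f, hU, hxU, hf, hsur, hSU⟩ := hS x hx
  have hfin : Module.finrank ℝ (Fin d → ℂ) = Module.finrank ℝ (Fin (2 * d) → ℝ) := by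
    rw [Module.finrank_fin_fun, Module.finrank_pi_fintype]
    simp [Complex.finrank_real_complex, mul_comm]
  let e : (Fin d → ℂ) ≃L[ℝ] (Fin (2 * d) → ℝ) := ContinuousLinearEquiv.ofFinrankEq hfin
  have hcd : ContDiffOn ℝ (⊤ : ℕ∞) f U := (holo_contDiffOn hU hf).restrict_scalars ℝ
  refine ⟨2 * d, U, fun y => e (f y), hU, hxU, e.contDiff.comp_contDiffOn hcd, ?_, ?_⟩
  · intro y hy
    have h1 : HasFDerivAt f (fderiv ℂ f y) y := (hf.differentiableAt (hU.mem_nhds hy)).hasFDerivAt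
    have h2 : HasFDerivAt f ((fderiv ℂ f y).restrictScalars ℝ) y := h1.restrictScalars ℝ
    have h3 : HasFDerivAt (fun y => e (f y))
      ((e : (Fin d → ℂ) →L[ℝ] (Fin (2 * d) → ℝ)).comp ((fderiv ℂ f y).restrictScalars ℝ)) y :=
      e.hasFDerivAt.comp y h2
    rw [h3.fderiv]
    exact e.surjective.comp (hsur y hy)
  · rw [hSU]
    ext y
    simp

end Helpers

/-- A smooth irreducible constructible subset `T` of the complex
affine Grassmannian `GrAff_i^ℂ(ℂ^n)` is a connected real submanifold satisfying
`L(U) = L(T)` for every nonempty open `U ⊆ T`; that is, `T` is a neat family. -/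
theorem stmt13 {n i : ℕ} (hi : i ≤ n) (T : Set (Set (Fin n → ℂ)))
    (hT : T ⊆ grAffC n i) (hTc : IsConstructibleSet (pre n i T))
    (hTsm : IsSmoothFam n i T) (hTirr : IsIrreducibleFam n i T) :
    IsNeatFamilyC n i T := by
  have hpr := vanI_prime hT hTirr
  have hne := pre_nonempty hT hTirr.1
  exact ⟨hT, hTc, loc_connected hTsm.1 hne hpr, real_submanifold hTsm.2,
    fun V hV h => dir_eq hTsm.1 (fun p hp => hp.1) hpr hV h⟩
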